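/- arXiv:1803.03749 — 7 statements merged into one kernel-verified Lean document; each statement's English description precedes it below -/
import Mathlib

section
/- For every n ≥ 1, the number of spanning trees of the fan graph Θₙ equals F_{2n}, the (2n)-th Fibonacci number. -/
/-- The number of spanning trees of a graph: the number of subgraphs (on the same
vertex set) that are trees, i.e. connected and acyclic. -/
noncomputable def spanningTreeCount {V : Type*} (G : SimpleGraph V) : ℕ :=
  Nat.card {H : SimpleGraph V // H ≤ G ∧ H.IsTree}

/-- The fan graph `Θₙ` on `n + 1` vertices: the hub is vertex `0`, the path vertices
are `1, …, n` joined consecutively, and the hub is joined to every path vertex. -/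
def fanGraph (n : ℕ) : SimpleGraph (Fin (n + 1)) :=
  SimpleGraph.fromRel (fun i j => i = 0 ∨ (i : ℕ) + 1 = (j : ℕ))

/-- `f` sends every vertex to its parent in some tree rooted at `r`: iterating `f` from any
vertex leads to `r`, which is fixed. -/
def IsParentMap {V : Type*} (r : V) (f : V → V) : Prop :=
  f r = r ∧ ∀ v, ∃ k, f^[k] v = r

namespace IsParentMap

variable {V : Type*} {r : V} {f : V → V}

lemma apply_ne (hf : IsParentMap r f) {v : V} (hv : v ≠ r) : f v ≠ v := by
  intro h
  obtain ⟨k, hk⟩ := hf.2 v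
  exact hv ((Function.iterate_fixed h k).symm.trans hk)

lemma apply_apply_ne (hf : IsParentMap r f) {v : V} (hv : v ≠ r) : f (f v) ≠ v := by
  intro h
  have hper : ∀ k, f^[k] v = v ∨ f^[k] v = f v := by
    intro k
    induction k with
    | zero => exact Or.inl rfl
    | succ k ih =>
      rw [Function.iterate_succ_apply']
      rcases ih with ih | ih <;> simp [ih, h]
  obtain ⟨k, hk⟩ := hf.2 v
  rcases hper k with h' | h'
  · exact hv (h'.symm.trans hk)
  · have hr : f v = r := h'.symm.trans hk
    rw [hr, hf.1] at h
    exact hv h.symm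

end IsParentMap

/-- The graph joining every vertex to its image under `f`. -/
def parentGraph {V : Type*} (f : V → V) : SimpleGraph V :=
  SimpleGraph.fromRel (fun a b => f a = b)

section ParentGraph

variable {V : Type*} {r : V} {f g : V → V}

lemma parentGraph_adj {a b : V} :
    (parentGraph f).Adj a b ↔ a ≠ b ∧ (f a = b ∨ f b = a) :=
  SimpleGraph.fromRel_adj _ _ _

lemma IsParentMap.adj (hf : IsParentMap r f) {v : V} (hv : v ≠ r) :
    (parentGraph f).Adj v (f v) :=
  parentGraph_adj.2 ⟨(hf.apply_ne hv).symm, Or.inl rfl⟩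

lemma IsParentMap.connected_parentGraph (hf : IsParentMap r f) :
    (parentGraph f).Connected := by
  have step : ∀ v, (parentGraph f).Reachable v (f v) := by
    intro v
    by_cases hv : v = r
    · rw [hv, hf.1]
    · exact (hf.adj hv).reachable
  have iter : ∀ k v, (parentGraph f).Reachable v (f^[k] v) := by
    intro k
    induction k with
    | zero => exact fun v => SimpleGraph.Reachable.refl v
    | succ k ih => exact fun v => (step v).trans (ih (f v))
  refine SimpleGraph.connected_iff_exists_forall_reachable _ |>.2 ⟨r, fun v => ?_⟩
  obtain ⟨k, hk⟩ := hf.2 v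
  exact (hk ▸ iter k v).symm

lemma IsParentMap.edgeSet_parentGraph_subset (hf : IsParentMap r f) :
    (parentGraph f).edgeSet ⊆ (fun v => s(v, f v)) '' {r}ᶜ := by
  intro e
  induction e with
  | h a b =>
    rw [SimpleGraph.mem_edgeSet, parentGraph_adj]
    rintro ⟨hab, rfl | rfl⟩
    · exact ⟨a, fun h => hab (by rw [Set.mem_singleton_iff.1 h, hf.1]), rfl⟩
    · exact ⟨b, fun h => hab (by rw [Set.mem_singleton_iff.1 h, hf.1]), Sym2.eq_swap⟩

lemma IsParentMap.isTree_parentGraph [Finite V] (hf : IsParentMap r f) :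
    (parentGraph f).IsTree := by
  rw [SimpleGraph.isTree_iff_connected_and_card]
  refine ⟨hf.connected_parentGraph, le_antisymm ?_
    hf.connected_parentGraph.card_vert_le_card_edgeSet_add_one⟩
  have h1 : (parentGraph f).edgeSet.ncard ≤ ({r}ᶜ : Set V).ncard :=
    (Set.ncard_le_ncard hf.edgeSet_parentGraph_subset (Set.toFinite _)).trans
      (Set.ncard_image_le (Set.toFinite _))
  have h2 := Set.ncard_add_ncard_compl ({r} : Set V)
  rw [Set.ncard_singleton] at h2
  rw [Nat.card_coe_set_eq]
  omega

lemma IsParentMap.eq_of_parentGraph_eq (hf : IsParentMap r f) (hg : IsParentMap r g)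
    (h : parentGraph f = parentGraph g) : f = g := by
  have key : ∀ k v, f^[k] v = r → f v = g v := by
    intro k
    induction k with
    | zero =>
      rintro v rfl
      exact hf.1.trans hg.1.symm
    | succ k ih =>
      intro v hk
      by_cases hv : v = r
      · rw [hv, hf.1, hg.1]
      have hadj := hf.adj hv
      rw [h, parentGraph_adj] at hadj
      rcases hadj.2 with h' | h'
      · exact h'.symm
      · exact absurd ((ih (f v) hk).trans h') (hf.apply_apply_ne hv)
  funext v
  obtain ⟨k, hk⟩ := hf.2 v
  exact key k v hk

lemma SimpleGraph.IsTree.exists_parentGraph_eq {T : SimpleGraph V} (hT : T.IsTree) (r : V) :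
    ∃ f, IsParentMap r f ∧ parentGraph f = T := by
  have closer : ∀ v, ∃ w, (v = r → w = r) ∧ (v ≠ r → T.Adj v w ∧ T.dist w r < T.dist v r) := by
    intro v
    by_cases hv : v = r
    · exact ⟨r, fun _ => rfl, fun h => absurd hv h⟩
    · obtain ⟨p, hp⟩ := hT.connected.exists_walk_length_eq_dist v r
      cases p with
      | nil => exact absurd rfl hv
      | cons hadj q =>
        refine ⟨_, fun h => absurd h hv, fun _ => ⟨hadj, ?_⟩⟩
        have := SimpleGraph.dist_le q
        rw [SimpleGraph.Walk.length_cons] at hp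
        omega
  choose f hroot hstep using closer
  have reach : ∀ d v, T.dist v r ≤ d → ∃ k, f^[k] v = r := by
    intro d
    induction d with
    | zero =>
      intro v hv
      exact ⟨0, hT.connected.dist_eq_zero_iff.1 (Nat.le_zero.1 hv)⟩
    | succ d ih =>
      intro v hd
      by_cases hv : v = r
      · exact ⟨0, hv⟩
      · obtain ⟨k, hk⟩ := ih (f v) (by have := (hstep v hv).2; omega)
        exact ⟨k + 1, hk⟩
  have hf : IsParentMap r f := ⟨hroot r rfl, fun v => reach _ v le_rfl⟩
  have hle : parentGraph f ≤ T := by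
    intro a b hab
    rw [parentGraph_adj] at hab
    rcases hab with ⟨hne, rfl | rfl⟩
    · exact (hstep a fun h => hne (by rw [hroot a h, h])).1
    · exact (hstep b fun h => hne (by rw [hroot b h, h])).1.symm
  exact ⟨f, hf, hle.antisymm
    ((SimpleGraph.isTree_iff_minimal_connected.1 hT).2 hf.connected_parentGraph hle)⟩

/-- Rooting at `r` identifies spanning trees with parent maps along edges. -/
lemma spanningTreeCount_eq_card_parentMap [Finite V] (G : SimpleGraph V) (r : V) :
    spanningTreeCount G =
      Nat.card {f : V → V // IsParentMap r f ∧ ∀ v, v ≠ r → G.Adj v (f v)} := by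
  symm
  refine Nat.card_eq_of_bijective
    (fun f => ⟨parentGraph f.1, ?_, f.2.1.isTree_parentGraph⟩) ⟨?_, ?_⟩
  · intro a b hab
    rw [parentGraph_adj] at hab
    have hroot := f.2.1.1
    rcases hab with ⟨hne, h | h⟩
    · exact h ▸ f.2.2 a fun ha => hne (by rw [← h, ha, hroot])
    · exact (h ▸ f.2.2 b fun hb => hne (by rw [← h, hb, hroot])).symm
  · intro f g h
    exact Subtype.ext (f.2.1.eq_of_parentGraph_eq g.2.1 (Subtype.ext_iff.1 h))
  · rintro ⟨T, hTG, hT⟩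
    obtain ⟨f, hf, rfl⟩ := hT.exists_parentGraph_eq r
    exact ⟨⟨f, hf, fun v hv => hTG (hf.adj hv)⟩, rfl⟩

end ParentGraph

/-- Words recording the direction from each vertex of the fan to its parent: `0` is the hub,
`1` the preceding and `2` the following path vertex. The letter `p` at the hub itself is a
boundary condition. -/
def directionWords (n : ℕ) (p : Fin 3) : Set (Fin (n + 1) → Fin 3) :=
  {c | c 0 = p ∧ (∀ i : Fin n, c i.castSucc = 2 → c i.succ ≠ 1) ∧ c (Fin.last n) ≠ 2}

lemma cons_mem_directionWords {n : ℕ} {p q x : Fin 3} {c : Fin (n + 1) → Fin 3} (hq : c 0 = q) :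
    (Fin.cons x c : Fin (n + 2) → Fin 3) ∈ directionWords (n + 1) p ↔
      x = p ∧ (p = 2 → q ≠ 1) ∧ c ∈ directionWords n q := by
  subst hq
  simp only [directionWords, Set.mem_ofPred_eq, Fin.cons_zero, Fin.forall_fin_succ (n := n),
    Fin.castSucc_zero, ← Fin.succ_castSucc, Fin.cons_succ, ← Fin.succ_last, true_and]
  constructor
  · rintro ⟨rfl, ⟨h1, h2⟩, h3⟩
    exact ⟨rfl, h1, h2, h3⟩
  · rintro ⟨rfl, h1, h2, h3⟩
    exact ⟨rfl, ⟨h1, h2⟩, h3⟩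

lemma directionWords_succ (n : ℕ) (p : Fin 3) :
    directionWords (n + 1) p =
      ⋃ q ∈ (Finset.univ.filter fun q : Fin 3 => p = 2 → q ≠ 1),
        Fin.cons p '' directionWords n q := by
  ext c
  rw [← Fin.cons_self_tail c, cons_mem_directionWords rfl]
  simp only [Set.mem_iUnion, Finset.mem_filter, Finset.mem_univ, true_and, Set.mem_image,
    exists_prop]
  constructor
  · rintro ⟨h, h1, h2⟩
    exact ⟨_, h1, _, h2, by rw [h]⟩
  · rintro ⟨q, h1, d, h2, h3⟩
    obtain ⟨h4, rfl⟩ := Fin.cons_inj.1 h3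
    have h5 := h2.1
    subst h5
    exact ⟨h4.symm, h1, h2⟩

lemma ncard_directionWords_succ (n : ℕ) (p : Fin 3) :
    (directionWords (n + 1) p).ncard =
      ∑ q ∈ (Finset.univ.filter fun q : Fin 3 => p = 2 → q ≠ 1), (directionWords n q).ncard := by
  rw [directionWords_succ]
  have hdisj : Set.PairwiseDisjoint
      (↑(Finset.univ.filter fun q : Fin 3 => p = 2 → q ≠ 1) : Set (Fin 3))
      fun q => (Fin.cons p '' directionWords n q : Set (Fin (n + 2) → Fin 3)) := by
    intro q _ q' _ hne
    refine Set.disjoint_image_iff (Fin.cons_right_injective (α := fun _ => Fin 3) p) |>.2 ?_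
    exact Set.disjoint_left.2 fun c hc hc' => hne (hc.1.symm.trans hc'.1)
  have h := (Finset.finite_toSet _).ncard_biUnion (fun _ _ => Set.toFinite _) hdisj
  rw [finsum_mem_coe_finset] at h
  refine h.trans (Finset.sum_congr rfl fun q _ => ?_)
  exact Set.ncard_image_of_injective _ (Fin.cons_right_injective (α := fun _ => Fin 3) p)

lemma ncard_directionWords (n : ℕ) :
    (directionWords n 0).ncard = Nat.fib (2 * n + 1) ∧
    (directionWords n 1).ncard = Nat.fib (2 * n + 1) ∧
    (directionWords n 2).ncard = Nat.fib (2 * n) := by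
  induction n with
  | zero =>
    have h : ∀ p : Fin 3, p ≠ 2 → directionWords 0 p = {fun _ => p} := by
      intro p hp
      ext c
      simp only [directionWords, Set.mem_ofPred_eq, Set.mem_singleton_iff, funext_iff,
        IsEmpty.forall_iff, true_and, (Fin.forall_fin_one : (∀ i : Fin (0 + 1), c i = p) ↔ c 0 = p)]
      exact ⟨fun h => h.1, fun h => ⟨h, fun h' => hp (h.symm.trans h')⟩⟩
    have h2 : directionWords 0 2 = ∅ := by
      ext c
      simp only [directionWords, Set.mem_ofPred_eq, Set.mem_empty_iff_false, iff_false]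
      exact fun h => h.2.2 h.1
    simp [h 0 (by decide), h 1 (by decide), h2]
  | succ n ih =>
    obtain ⟨h0, h1, h2⟩ := ih
    have e1 : Nat.fib (2 * (n + 1)) = Nat.fib (2 * n) + Nat.fib (2 * n + 1) := Nat.fib_add_two
    have e2 : Nat.fib (2 * (n + 1) + 1) = Nat.fib (2 * n + 1) + Nat.fib (2 * (n + 1)) :=
      Nat.fib_add_two
    simp only [ncard_directionWords_succ, Finset.sum_filter, Fin.sum_univ_three, h0, h1, h2]
    simp
    omega

/-- The parent map on the fan described by a word of directions. -/
def fanParent {n : ℕ} (c : Fin (n + 1) → Fin 3) (i : Fin (n + 1)) : Fin (n + 1) :=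
  ⟨if i = 0 ∨ c i = 0 then 0 else if c i = 1 then i - 1 else min (i + 1) n, by
    split_ifs <;> omega⟩

lemma fanGraph_adj {n : ℕ} {i j : Fin (n + 1)} :
    (fanGraph n).Adj i j ↔
      i ≠ j ∧ ((i = 0 ∨ (i : ℕ) + 1 = j) ∨ (j = 0 ∨ (j : ℕ) + 1 = i)) :=
  SimpleGraph.fromRel_adj _ _ _

section FanParent

variable {n : ℕ} {c : Fin (n + 1) → Fin 3}

lemma ne_one_of_mem_directionWords {p : Fin 3} (hc : c ∈ directionWords n p)
    {i j : Fin (n + 1)} (hij : (i : ℕ) + 1 = j) (hi : c i = 2) : c j ≠ 1 := by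
  have h := hc.2.1 ⟨i, by omega⟩
  have e1 : (⟨i, by omega⟩ : Fin n).castSucc = i := rfl
  have e2 : (⟨i, by omega⟩ : Fin n).succ = j := Fin.ext hij
  rw [e1, e2] at h
  exact h hi

lemma lt_of_mem_directionWords {p : Fin 3} (hc : c ∈ directionWords n p)
    {i : Fin (n + 1)} (hi : c i = 2) : (i : ℕ) < n := by
  have : i ≠ Fin.last n := fun h => hc.2.2 (h ▸ hi)
  exact Fin.lt_last_iff_ne_last.2 this

lemma two_le_of_mem_directionWords (hc : c ∈ directionWords n 2)
    {i : Fin (n + 1)} (hi : c i = 1) : 2 ≤ (i : ℕ) := by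
  have h0 : i ≠ 0 := by
    rintro rfl
    rw [hc.1] at hi
    exact absurd hi (by decide)
  have h1 : (i : ℕ) ≠ 1 := fun h =>
    ne_one_of_mem_directionWords hc (i := 0) (by simp [h]) hc.1 hi
  have := Fin.val_ne_zero_iff.2 h0
  omega

/-- The four ways in which `fanParent` can act, for a word with the right boundary values. -/
lemma fanParent_cases (hc : c ∈ directionWords n 2) (i : Fin (n + 1)) :
    (i = 0 ∧ c i = 2 ∧ (fanParent c i : ℕ) = 0) ∨
    ((i : ℕ) ≠ 0 ∧ c i = 0 ∧ (fanParent c i : ℕ) = 0) ∨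
    (2 ≤ (i : ℕ) ∧ c i = 1 ∧ (fanParent c i : ℕ) + 1 = i) ∨
    ((i : ℕ) ≠ 0 ∧ (i : ℕ) < n ∧ c i = 2 ∧ (fanParent c i : ℕ) = i + 1) := by
  by_cases h0 : i = 0
  · subst h0
    exact Or.inl ⟨rfl, hc.1, by simp [fanParent]⟩
  have h0' := Fin.val_ne_zero_iff.2 h0
  have hci : c i = 0 ∨ c i = 1 ∨ c i = 2 := by
    generalize c i = x
    revert x
    decide
  rcases hci with h | h | h
  · exact Or.inr (Or.inl ⟨h0', h, by simp [fanParent, h]⟩)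
  · have := two_le_of_mem_directionWords hc h
    refine Or.inr (Or.inr (Or.inl ⟨this, h, ?_⟩))
    simp [fanParent, h, h0]
    omega
  · have := lt_of_mem_directionWords hc h
    refine Or.inr (Or.inr (Or.inr ⟨h0', this, h, ?_⟩))
    simp [fanParent, h, h0]
    omega

lemma isParentMap_fanParent (hc : c ∈ directionWords n 2) : IsParentMap 0 (fanParent c) := by
  have hroot : fanParent c 0 = 0 := by simp [fanParent]
  have back : ∀ m, ∀ i : Fin (n + 1), (i : ℕ) = m → c i ≠ 2 → ∃ k, (fanParent c)^[k] i = 0 := by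
    intro m
    induction m with
    | zero => exact fun i hi _ => ⟨0, Fin.ext hi⟩
    | succ m ih =>
      intro i hi hci
      rcases fanParent_cases hc i with h | h | h | h
      · exact ⟨0, h.1⟩
      · exact ⟨1, Fin.ext h.2.2⟩
      · obtain ⟨k, hk⟩ := ih (fanParent c i) (by omega)
          fun h' => ne_one_of_mem_directionWords hc h.2.2 h' h.2.1
        exact ⟨k + 1, hk⟩
      · exact absurd h.2.2.1 hci
  have forth : ∀ m, ∀ i : Fin (n + 1), (i : ℕ) + m = n → ∃ k, (fanParent c)^[k] i = 0 := by
    intro m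
    induction m with
    | zero =>
      intro i hi
      exact back _ i rfl fun h => (lt_of_mem_directionWords hc h).ne hi
    | succ m ih =>
      intro i hi
      by_cases hci : c i = 2
      · rcases fanParent_cases hc i with h | h | h | h
        · exact ⟨0, h.1⟩
        · exact ⟨1, Fin.ext h.2.2⟩
        · exact back _ i rfl (by rw [h.2.1]; decide)
        · obtain ⟨k, hk⟩ := ih (fanParent c i) (by omega)
          exact ⟨k + 1, hk⟩
      · exact back _ i rfl hci
  exact ⟨hroot, fun i => forth (n - i) i (by omega)⟩

lemma fanGraph_adj_fanParent (hc : c ∈ directionWords n 2) {i : Fin (n + 1)} (hi : i ≠ 0) :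
    (fanGraph n).Adj i (fanParent c i) := by
  rw [fanGraph_adj]
  refine ⟨((isParentMap_fanParent hc).apply_ne hi).symm, ?_⟩
  rcases fanParent_cases hc i with h | h | h | h
  · exact absurd h.1 hi
  · exact Or.inr (Or.inl (Fin.ext h.2.2))
  · exact Or.inr (Or.inr h.2.2)
  · exact Or.inl (Or.inr h.2.2.2.symm)

lemma fanParent_injOn : Set.InjOn (fanParent (n := n)) (directionWords n 2) := by
  intro c hc d hd h
  funext i
  have hi : (fanParent c i : ℕ) = fanParent d i := by rw [h]
  rcases fanParent_cases hc i with h1 | h1 | h1 | h1 <;>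
    rcases fanParent_cases hd i with h2 | h2 | h2 | h2 <;>
    grind

lemma exists_fanParent_eq (hn : 1 ≤ n) {f : Fin (n + 1) → Fin (n + 1)} (hf : IsParentMap 0 f)
    (hadj : ∀ i, i ≠ 0 → (fanGraph n).Adj i (f i)) :
    ∃ c ∈ directionWords n 2, fanParent c = f := by
  have hadj' : ∀ i, i ≠ 0 → f i = 0 ∨ (i : ℕ) + 1 = f i ∨ (f i : ℕ) + 1 = i := by
    intro i hi
    have := (fanGraph_adj.1 (hadj i hi)).2
    tauto
  let c : Fin (n + 1) → Fin 3 := fun i =>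
    if i = 0 then 2 else if f i = 0 then 0 else if (f i : ℕ) < i then 1 else 2
  have hc : c ∈ directionWords n 2 := by
    refine ⟨by simp [c], fun i h1 h2 => ?_, fun h => ?_⟩
    · by_cases h0 : i.castSucc = 0
      · have := congrArg Fin.val h0
        have := hadj' i.succ
        grind [Fin.val_castSucc]
      · have h3 := hf.apply_apply_ne h0
        have h4 := hadj' _ h0
        have h5 := hadj' i.succ (Fin.succ_ne_zero i)
        have h6 : f i.castSucc = i.succ := by
          apply Fin.ext
          simp only [Fin.val_succ, Fin.val_castSucc] at *
          grind
        rw [h6] at h3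
        apply h3
        apply Fin.ext
        simp only [Fin.val_succ, Fin.val_castSucc] at *
        grind
    · have := hadj' (Fin.last n)
      grind
  refine ⟨c, hc, ?_⟩
  funext i
  by_cases hi : i = 0
  · rw [hi, hf.1, (isParentMap_fanParent hc).1]
  have h3 := hadj' i hi
  have h4 := fanParent_cases hc i
  apply Fin.ext
  grind

end FanParent

lemma card_parentMap_fanGraph {n : ℕ} (hn : 1 ≤ n) :
    Nat.card {f : Fin (n + 1) → Fin (n + 1) //
      IsParentMap 0 f ∧ ∀ i, i ≠ 0 → (fanGraph n).Adj i (f i)} =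
    (directionWords n 2).ncard := by
  rw [← Nat.card_coe_set_eq]
  symm
  refine Nat.card_eq_of_bijective
    (fun c => ⟨fanParent c.1, isParentMap_fanParent c.2, fun i => fanGraph_adj_fanParent c.2⟩)
    ⟨?_, ?_⟩
  · intro c d h
    exact Subtype.ext (fanParent_injOn c.2 d.2 (Subtype.ext_iff.1 h))
  · rintro ⟨f, hf, hadj⟩
    obtain ⟨c, hc, rfl⟩ := exists_fanParent_eq hn hf hadj
    exact ⟨⟨c, hc⟩, rfl⟩

/-- The number of spanning trees of the fan `Θₙ` is the Fibonacci number `F₂ₙ`. -/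
theorem spanningTreeCount_fanGraph (n : ℕ) (hn : 1 ≤ n) :
    spanningTreeCount (fanGraph n) = Nat.fib (2 * n) := by
  rw [spanningTreeCount_eq_card_parentMap _ 0, card_parentMap_fanGraph hn]
  exact (ncard_directionWords n).2.2
end

section
/- Let aₙ denote the number of spanning trees of the fan graph Θₙ. Then for every n ≥ 1, aₙ = (1/√5) · ( ((3+√5)/2)ⁿ − ((3−√5)/2)ⁿ ). -/
namespace SimpleGraph

theorem Reachable.of_adj_imp {V W : Type*} {G : SimpleGraph V} {H : SimpleGraph W} {f : V → W}
    (hf : ∀ a b, G.Adj a b → H.Reachable (f a) (f b)) {a b : V} (hab : G.Reachable a b) :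
    H.Reachable (f a) (f b) := by
  obtain ⟨p⟩ := hab
  induction p with
  | nil => exact .rfl
  | cons h _ ih => exact (hf _ _ h).trans ih

theorem connected_iff_of_reachable_maps {V W : Type*} {G : SimpleGraph V} {H : SimpleGraph W}
    (f : V → W) (g : W → V) (hf : ∀ a b, G.Adj a b → H.Reachable (f a) (f b))
    (hg : ∀ a b, H.Adj a b → G.Reachable (g a) (g b)) (hgf : ∀ v, G.Reachable v (g (f v)))
    (hfg : ∀ w, H.Reachable w (f (g w))) : G.Connected ↔ H.Connected := by
  rw [connected_iff, connected_iff]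
  constructor
  · rintro ⟨h, ⟨v⟩⟩
    exact ⟨fun a b => (hfg a).trans (((h _ _).of_adj_imp hf).trans (hfg b).symm), ⟨f v⟩⟩
  · rintro ⟨h, ⟨w⟩⟩
    exact ⟨fun a b => (hgf a).trans (((h _ _).of_adj_imp hg).trans (hgf b).symm), ⟨g w⟩⟩

theorem ncard_edgeSet_sup_edge {V : Type*} [Finite V] {G : SimpleGraph V} {s t : V}
    (hn : ¬G.Adj s t) (h : s ≠ t) : (G ⊔ edge s t).edgeSet.ncard = G.edgeSet.ncard + 1 := by
  rw [edgeSet_sup, edgeSet_edge_of_ne h, Set.union_singleton, Set.ncard_insert_of_notMem (by simpa using hn)]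

theorem IsTree.not_adj_of_adj_of_adj {V : Type*} {G : SimpleGraph V} (hG : G.IsTree) {a b c : V}
    (hab : G.Adj a b) (hac : G.Adj a c) : ¬G.Adj b c := fun hbc => by
  classical
  exact hG.isAcyclic.cliqueFree le_rfl {a, b, c} (is3Clique_triple_iff.2 ⟨hab, hac, hbc⟩)

variable {n : ℕ}

/-- The graph `K` together with a new last vertex, joined to `x` only. -/
def addLeaf (K : SimpleGraph (Fin n)) (x : Fin n) : SimpleGraph (Fin (n + 1)) :=
  K.map Fin.castSuccEmb ⊔ edge (Fin.last n) x.castSucc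

/-- The graph `K` together with a new last vertex, joined to `x` and `y` only. -/
def addEar (K : SimpleGraph (Fin n)) (x y : Fin n) : SimpleGraph (Fin (n + 1)) :=
  K.addLeaf x ⊔ edge (Fin.last n) y.castSucc

@[simp]
theorem addLeaf_adj_castSucc {K : SimpleGraph (Fin n)} {x a b : Fin n} :
    (K.addLeaf x).Adj a.castSucc b.castSucc ↔ K.Adj a b := by
  simp [addLeaf, edge_adj, map_adj']
  grind [SimpleGraph.Adj.ne]

@[simp]
theorem addLeaf_adj_last {K : SimpleGraph (Fin n)} {x a : Fin n} :
    (K.addLeaf x).Adj (Fin.last n) a.castSucc ↔ a = x := by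
  simp [addLeaf, edge_adj, map_adj', (Fin.castSucc_ne_last _).symm]

@[simp]
theorem addEar_adj_castSucc {K : SimpleGraph (Fin n)} {x y a b : Fin n} :
    (K.addEar x y).Adj a.castSucc b.castSucc ↔ K.Adj a b := by
  simp [addEar, edge_adj]

@[simp]
theorem addEar_adj_last {K : SimpleGraph (Fin n)} {x y a : Fin n} :
    (K.addEar x y).Adj (Fin.last n) a.castSucc ↔ a = x ∨ a = y := by
  simp [addEar, edge_adj, (Fin.castSucc_ne_last _).symm]

@[simp]
theorem addLeaf_adj_last_zero {K : SimpleGraph (Fin (n + 1))} {x : Fin (n + 1)} :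
    (K.addLeaf x).Adj (Fin.last (n + 1)) 0 ↔ 0 = x :=
  addLeaf_adj_last (a := 0)

@[simp]
theorem addEar_adj_last_zero {K : SimpleGraph (Fin (n + 1))} {x y : Fin (n + 1)} :
    (K.addEar x y).Adj (Fin.last (n + 1)) 0 ↔ 0 = x ∨ 0 = y :=
  addEar_adj_last (a := 0)

theorem ext_castSucc_last {G H : SimpleGraph (Fin (n + 1))}
    (h : ∀ a b : Fin n, G.Adj a.castSucc b.castSucc ↔ H.Adj a.castSucc b.castSucc)
    (hl : ∀ a : Fin n, G.Adj (Fin.last n) a.castSucc ↔ H.Adj (Fin.last n) a.castSucc) :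
    G = H := by
  ext a b
  induction a using Fin.lastCases <;> induction b using Fin.lastCases
  · simp
  · exact hl _
  · rw [G.adj_comm, H.adj_comm]
    exact hl _
  · exact h _ _

theorem le_iff_castSucc_last {G H : SimpleGraph (Fin (n + 1))} :
    G ≤ H ↔ (∀ a b : Fin n, G.Adj a.castSucc b.castSucc → H.Adj a.castSucc b.castSucc) ∧
      ∀ a : Fin n, G.Adj (Fin.last n) a.castSucc → H.Adj (Fin.last n) a.castSucc := by
  refine ⟨fun h => ⟨fun _ _ hab => h hab, fun _ ha => h ha⟩, fun ⟨h, hl⟩ a b => ?_⟩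
  induction a using Fin.lastCases <;> induction b using Fin.lastCases
  · simp
  · exact hl _
  · rw [G.adj_comm, H.adj_comm]
    exact hl _
  · exact h _ _

theorem ncard_edgeSet_addLeaf (K : SimpleGraph (Fin n)) (x : Fin n) :
    (K.addLeaf x).edgeSet.ncard = K.edgeSet.ncard + 1 := by
  rw [addLeaf, ncard_edgeSet_sup_edge _ (Fin.castSucc_ne_last _).symm, edgeSet_map,
    Set.ncard_image_of_injective _ (Function.Embedding.injective _)]
  simp [map_adj']

theorem ncard_edgeSet_addEar (K : SimpleGraph (Fin n)) {x y : Fin n} (hxy : x ≠ y) :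
    (K.addEar x y).edgeSet.ncard = K.edgeSet.ncard + 2 := by
  rw [addEar, ncard_edgeSet_sup_edge _ (Fin.castSucc_ne_last _).symm, ncard_edgeSet_addLeaf]
  simpa using hxy.symm

theorem isTree_addLeaf {K : SimpleGraph (Fin n)} {x : Fin n} :
    (K.addLeaf x).IsTree ↔ K.IsTree := by
  rw [isTree_iff_connected_and_card, isTree_iff_connected_and_card, Nat.card_coe_set_eq,
    Nat.card_coe_set_eq, ncard_edgeSet_addLeaf, Nat.card_fin, Nat.card_fin, add_left_inj]
  refine and_congr_left fun _ => (connected_iff_of_reachable_maps Fin.castSucc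
    (Fin.lastCases x id) (fun a b h => ?_) (fun a b h => ?_) (fun v => ?_) (fun w => ?_)).symm
  · exact (addLeaf_adj_castSucc.2 h).reachable
  · induction a using Fin.lastCases <;> induction b using Fin.lastCases
    · simp
    · simp_all
    · rw [adj_comm] at h
      simp_all
    · simpa using (addLeaf_adj_castSucc.1 h).reachable
  · simp
  · induction w using Fin.lastCases
    · simpa using (addLeaf_adj_last.2 rfl).reachable
    · simp

theorem isTree_addEar {K : SimpleGraph (Fin n)} {x y : Fin n} (hxy : x ≠ y) (hK : ¬K.Adj x y) :
    (K.addEar x y).IsTree ↔ (K ⊔ edge x y).IsTree := by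
  rw [isTree_iff_connected_and_card, isTree_iff_connected_and_card, Nat.card_coe_set_eq,
    Nat.card_coe_set_eq, ncard_edgeSet_addEar K hxy, ncard_edgeSet_sup_edge hK hxy, Nat.card_fin,
    Nat.card_fin, add_left_inj]
  refine and_congr_left fun _ => (connected_iff_of_reachable_maps Fin.castSucc
    (Fin.lastCases x id) (fun a b h => ?_) (fun a b h => ?_) (fun v => ?_) (fun w => ?_)).symm
  · have hx : (K.addEar x y).Adj (Fin.last n) x.castSucc := by simp
    have hy : (K.addEar x y).Adj (Fin.last n) y.castSucc := by simp
    rw [sup_adj, edge_adj] at h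
    obtain h | ⟨⟨rfl, rfl⟩ | ⟨rfl, rfl⟩, _⟩ := h
    · exact (addEar_adj_castSucc.2 h).reachable
    · exact hx.symm.reachable.trans hy.reachable
    · exact hy.symm.reachable.trans hx.reachable
  · have hxy' : (K ⊔ edge x y).Adj x y := by simp [edge_adj, hxy]
    induction a using Fin.lastCases <;> induction b using Fin.lastCases
    · simp
    · obtain rfl | rfl := addEar_adj_last.1 h
      · simp
      · simpa using hxy'.reachable
    · obtain rfl | rfl := addEar_adj_last.1 h.symm
      · simp
      · simpa using hxy'.symm.reachable
    · simpa using ((addEar_adj_castSucc.1 h).reachable).mono le_sup_left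
  · simp
  · induction w using Fin.lastCases
    · simpa using (addEar_adj_last.2 (.inl rfl)).reachable
    · simp

end SimpleGraph

theorem fanGraph_adj_castSucc {n : ℕ} {a b : Fin (n + 1)} :
    (fanGraph (n + 1)).Adj a.castSucc b.castSucc ↔ (fanGraph n).Adj a b := by
  simp [fanGraph]

theorem fanGraph_adj_last {n : ℕ} {a : Fin (n + 1)} :
    (fanGraph (n + 1)).Adj (Fin.last (n + 1)) a.castSucc ↔ a = 0 ∨ a = Fin.last n := by
  simp [fanGraph, Fin.ext_iff, -Fin.val_eq_zero_iff]
  omega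

theorem addLeaf_le_fanGraph_iff {n : ℕ} {K : SimpleGraph (Fin (n + 1))} {x : Fin (n + 1)} :
    K.addLeaf x ≤ fanGraph (n + 1) ↔ K ≤ fanGraph n ∧ (x = 0 ∨ x = Fin.last n) := by
  rw [SimpleGraph.le_iff_castSucc_last]
  simp [fanGraph_adj_castSucc, fanGraph_adj_last, SimpleGraph.le_iff_adj]

theorem addEar_le_fanGraph_iff {n : ℕ} {K : SimpleGraph (Fin (n + 1))} :
    K.addEar 0 (Fin.last n) ≤ fanGraph (n + 1) ↔ K ≤ fanGraph n := by
  rw [SimpleGraph.le_iff_castSucc_last]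
  simp [fanGraph_adj_castSucc, fanGraph_adj_last, SimpleGraph.le_iff_adj]

/-- The spanning trees of the fan graph. -/
def fanTrees (n : ℕ) : Set (SimpleGraph (Fin (n + 1))) :=
  {H | H ≤ fanGraph n ∧ H.IsTree}

/-- The spanning trees of the fan graph in which the hub is joined to the last path vertex. -/
def spokedFanTrees (n : ℕ) : Set (SimpleGraph (Fin (n + 1))) :=
  {H ∈ fanTrees n | H.Adj (Fin.last n) 0}

/-- The subdivision of the last spoke of a fan by a new last path vertex. -/
def subdivideSpoke {n : ℕ} (K : SimpleGraph (Fin (n + 1))) : SimpleGraph (Fin (n + 2)) :=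
  (K \ SimpleGraph.edge 0 (Fin.last n)).addEar 0 (Fin.last n)

theorem addLeaf_injective {n : ℕ} (x : Fin n) :
    Function.Injective fun K : SimpleGraph (Fin n) => K.addLeaf x := fun K L h => by
  ext a b
  simpa using congrArg (fun G => G.Adj a.castSucc b.castSucc) h

theorem injOn_subdivideSpoke (n : ℕ) : Set.InjOn subdivideSpoke (spokedFanTrees n) := by
  intro K hK L hL h
  ext a b
  have hab := congrArg (fun G => G.Adj a.castSucc b.castSucc) h
  simp only [subdivideSpoke, SimpleGraph.addEar_adj_castSucc, SimpleGraph.sdiff_adj,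
    SimpleGraph.edge_adj] at hab
  have := hK.2
  have := hL.2
  grind [SimpleGraph.adj_comm, SimpleGraph.Adj.ne]

theorem subdivideSpoke_mem_fanTrees {n : ℕ} (hn : n ≠ 0) {K : SimpleGraph (Fin (n + 1))}
    (hK : K ∈ spokedFanTrees n) : subdivideSpoke K ∈ fanTrees (n + 1) := by
  have h0 : (0 : Fin (n + 1)) ≠ Fin.last n := by simpa [Fin.ext_iff] using hn.symm
  refine ⟨addEar_le_fanGraph_iff.2 (sdiff_le.trans hK.1.1), ?_⟩
  rw [subdivideSpoke, SimpleGraph.isTree_addEar h0 (by simp [SimpleGraph.edge_adj, h0]),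
    sdiff_sup_cancel ((SimpleGraph.edge_le_iff _).2 (.inr hK.2.symm))]
  exact hK.1.2

theorem addLeaf_mem_fanTrees_iff {n : ℕ} {K : SimpleGraph (Fin (n + 1))} {x : Fin (n + 1)}
    (hx : x = 0 ∨ x = Fin.last n) : K.addLeaf x ∈ fanTrees (n + 1) ↔ K ∈ fanTrees n := by
  simp [fanTrees, addLeaf_le_fanGraph_iff, SimpleGraph.isTree_addLeaf, hx]

theorem exists_of_mem_fanTrees {n : ℕ} (hn : n ≠ 0) {H : SimpleGraph (Fin (n + 2))}
    (hH : H ∈ fanTrees (n + 1)) :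
    (∃ K ∈ fanTrees n, K.addLeaf 0 = H) ∨ (∃ K ∈ fanTrees n, K.addLeaf (Fin.last n) = H) ∨
      ∃ K ∈ spokedFanTrees n, subdivideSpoke K = H := by
  have h0 : (0 : Fin (n + 1)) ≠ Fin.last n := by simpa [Fin.ext_iff] using hn.symm
  have hl : ∀ a : Fin (n + 1), H.Adj (Fin.last (n + 1)) a.castSucc → a = 0 ∨ a = Fin.last n :=
    fun a ha => fanGraph_adj_last.1 (hH.1 ha)
  have leaf : ∀ x, x = 0 ∨ x = Fin.last n →
      (∀ a : Fin (n + 1), H.Adj (Fin.last (n + 1)) a.castSucc ↔ a = x) →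
      ∃ K ∈ fanTrees n, K.addLeaf x = H := by
    intro x hx h
    have hK : (H.comap Fin.castSucc).addLeaf x = H :=
      SimpleGraph.ext_castSucc_last (by simp) (by simp [h])
    exact ⟨_, (addLeaf_mem_fanTrees_iff hx).1 (by rwa [hK]), hK⟩
  by_cases hz : H.Adj (Fin.last (n + 1)) (Fin.castSucc 0) <;>
    by_cases hw : H.Adj (Fin.last (n + 1)) (Fin.last n).castSucc
  · have hnot : ¬(H.comap Fin.castSucc).Adj 0 (Fin.last n) := hH.2.not_adj_of_adj_of_adj hz hw
    have hK : (H.comap Fin.castSucc).addEar 0 (Fin.last n) = H :=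
      SimpleGraph.ext_castSucc_last (by simp) (by grind [SimpleGraph.addEar_adj_last])
    refine .inr (.inr ⟨H.comap Fin.castSucc ⊔ SimpleGraph.edge 0 (Fin.last n),
      ⟨⟨sup_le (addEar_le_fanGraph_iff.1 (hK.le.trans hH.1)) ?_, ?_⟩, ?_⟩, ?_⟩)
    · exact (SimpleGraph.edge_le_iff _).2 (.inr (by simp [fanGraph, h0]))
    · exact (SimpleGraph.isTree_addEar h0 hnot).1 (by rw [hK]; exact hH.2)
    · simp [SimpleGraph.edge_adj, h0.symm]
    · rw [subdivideSpoke, sup_sdiff_right_self, SimpleGraph.sdiff_edge _ hnot, hK]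
  · exact .inl (leaf 0 (.inl rfl) (by grind))
  · exact .inr (.inl (leaf _ (.inr rfl) (by grind)))
  · obtain ⟨u, hu⟩ := hH.2.connected.preconnected.exists_adj_of_nontrivial (Fin.last (n + 1))
    induction u using Fin.lastCases with
    | last => exact absurd hu (H.irrefl)
    | cast a => grind

theorem ncard_fanTrees_succ {n : ℕ} (hn : n ≠ 0) :
    (fanTrees (n + 1)).ncard = 2 * (fanTrees n).ncard + (spokedFanTrees n).ncard := by
  have h0 : (0 : Fin (n + 1)) ≠ Fin.last n := by simpa [Fin.ext_iff] using hn.symm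
  have h : fanTrees (n + 1) = ((·.addLeaf 0) '' fanTrees n ∪ (·.addLeaf (Fin.last n)) '' fanTrees n)
      ∪ subdivideSpoke '' spokedFanTrees n := by
    apply Set.Subset.antisymm
    · intro H hH
      simpa [or_assoc] using exists_of_mem_fanTrees hn hH
    · rintro _ ((⟨K, hK, rfl⟩ | ⟨K, hK, rfl⟩) | ⟨K, hK, rfl⟩)
      · exact (addLeaf_mem_fanTrees_iff (.inl rfl)).2 hK
      · exact (addLeaf_mem_fanTrees_iff (.inr rfl)).2 hK
      · exact subdivideSpoke_mem_fanTrees hn hK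
  rw [h, Set.ncard_union_eq, Set.ncard_union_eq, (addLeaf_injective _).injOn.ncard_image,
    (addLeaf_injective _).injOn.ncard_image, (injOn_subdivideSpoke n).ncard_image, two_mul]
  · rw [Set.disjoint_left]
    rintro _ ⟨K, hK, rfl⟩ ⟨L, hL, h⟩
    simpa [h0] using congrArg (fun G => G.Adj (Fin.last (n + 1)) (Fin.castSucc 0)) h
  · rw [Set.disjoint_left]
    rintro _ (⟨K, hK, rfl⟩ | ⟨K, hK, rfl⟩) ⟨L, hL, h⟩
    · simpa [subdivideSpoke, h0.symm] using
        congrArg (fun G => G.Adj (Fin.last (n + 1)) (Fin.last n).castSucc) h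
    · simpa [subdivideSpoke, h0] using
        congrArg (fun G => G.Adj (Fin.last (n + 1)) (Fin.castSucc 0)) h

theorem ncard_spokedFanTrees_succ {n : ℕ} (hn : n ≠ 0) :
    (spokedFanTrees (n + 1)).ncard = (fanTrees n).ncard + (spokedFanTrees n).ncard := by
  have h0 : (0 : Fin (n + 1)) ≠ Fin.last n := by simpa [Fin.ext_iff] using hn.symm
  have h : spokedFanTrees (n + 1) =
      (·.addLeaf 0) '' fanTrees n ∪ subdivideSpoke '' spokedFanTrees n := by
    apply Set.Subset.antisymm
    · rintro H ⟨hH, hadj⟩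
      obtain h | ⟨K, hK, rfl⟩ | h := exists_of_mem_fanTrees hn hH
      · exact .inl h
      · rw [SimpleGraph.addLeaf_adj_last_zero] at hadj
        exact absurd hadj h0
      · exact .inr h
    · rintro _ (⟨K, hK, rfl⟩ | ⟨K, hK, rfl⟩)
      · refine ⟨(addLeaf_mem_fanTrees_iff (.inl rfl)).2 hK, SimpleGraph.addLeaf_adj_last_zero.2 rfl⟩
      · refine ⟨subdivideSpoke_mem_fanTrees hn hK, SimpleGraph.addEar_adj_last_zero.2 (.inl rfl)⟩
  rw [h, Set.ncard_union_eq, (addLeaf_injective _).injOn.ncard_image,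
    (injOn_subdivideSpoke n).ncard_image]
  rw [Set.disjoint_left]
  rintro _ ⟨K, hK, rfl⟩ ⟨L, hL, h⟩
  simpa [subdivideSpoke, h0.symm] using
    congrArg (fun G => G.Adj (Fin.last (n + 1)) (Fin.last n).castSucc) h

theorem fanTrees_one : fanTrees 1 = {(⊥ : SimpleGraph (Fin 1)).addLeaf 0} := by
  ext H
  constructor
  · rintro ⟨-, hH⟩
    obtain ⟨u, hu⟩ := hH.connected.preconnected.exists_adj_of_nontrivial (Fin.last 1)
    refine SimpleGraph.ext_castSucc_last (by simp [Subsingleton.elim _ (0 : Fin 1)]) fun a => ?_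
    induction u using Fin.lastCases with
    | last => exact absurd hu H.irrefl
    | cast b =>
      obtain rfl := Subsingleton.elim a b
      exact iff_of_true hu (SimpleGraph.addLeaf_adj_last.2 (Subsingleton.elim _ _))
  · rintro rfl
    have : Subsingleton (Fin (0 + 1)) := inferInstanceAs (Subsingleton (Fin 1))
    exact (addLeaf_mem_fanTrees_iff (.inl rfl)).2 ⟨bot_le, .of_subsingleton⟩

theorem spokedFanTrees_one : spokedFanTrees 1 = fanTrees 1 := by
  refine Set.sep_eq_self_iff_mem_true.2 fun H hH => ?_
  rw [fanTrees_one, Set.mem_singleton_iff] at hH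
  exact hH ▸ SimpleGraph.addLeaf_adj_last_zero.2 rfl

theorem ncard_fanTrees_and_ncard_spokedFanTrees (n : ℕ) :
    (fanTrees (n + 1)).ncard = Nat.fib (2 * n + 2) ∧
      (spokedFanTrees (n + 1)).ncard = Nat.fib (2 * n + 1) := by
  induction n with
  | zero => simp [spokedFanTrees_one, fanTrees_one]
  | succ n ih =>
    rw [ncard_fanTrees_succ n.succ_ne_zero, ncard_spokedFanTrees_succ n.succ_ne_zero, ih.1, ih.2]
    have h1 : Nat.fib (2 * n + 3) = _ := Nat.fib_add_two
    have h2 : Nat.fib (2 * n + 4) = _ := Nat.fib_add_two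
    grind

/-- Closed form: `aₙ = (1/√5) ⬝ (((3+√5)/2)ⁿ − ((3−√5)/2)ⁿ)`. -/
theorem spanningTreeCount_fanGraph_closedForm (n : ℕ) (hn : 1 ≤ n) :
    (spanningTreeCount (fanGraph n) : ℝ) =
      (1 / Real.sqrt 5) *
        (((3 + Real.sqrt 5) / 2) ^ n - ((3 - Real.sqrt 5) / 2) ^ n) := by
  obtain ⟨m, rfl⟩ := Nat.exists_eq_add_of_le' hn
  have h : spanningTreeCount (fanGraph (m + 1)) = Nat.fib (2 * (m + 1)) :=
    (Nat.card_coe_set_eq _).trans (ncard_fanTrees_and_ncard_spokedFanTrees m).1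
  have h5 : Real.sqrt 5 ^ 2 = 5 := Real.sq_sqrt (by norm_num)
  have hφ : Real.goldenRatio ^ 2 = (3 + Real.sqrt 5) / 2 := by
    rw [Real.goldenRatio]
    linear_combination h5 / 4
  have hψ : Real.goldenConj ^ 2 = (3 - Real.sqrt 5) / 2 := by
    rw [Real.goldenConj]
    linear_combination h5 / 4
  rw [h, Real.coe_fib_eq, pow_mul, pow_mul, hφ, hψ]
  ring
end

section
/- Let bₙ denote the number of spanning trees of the ladder graph Λₙ with n rungs. Then b₁ = 1, b₂ = 4, and for every n ≥ 2, b_{n+1} = 4·bₙ − b_{n−1}. -/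
/-- The ladder graph `Λₙ` with `n` rungs: the Cartesian (box) product of a path on
`n` vertices with a single edge `K₂`. -/
def ladderGraph (n : ℕ) : SimpleGraph (Fin n × Fin 2) :=
  (SimpleGraph.pathGraph n).boxProd (SimpleGraph.pathGraph 2)

open SimpleGraph

/-- Connectedness as constancy of the locally constant predicates, with values compared to the
value at a base vertex. -/
theorem SimpleGraph.connected_iff_forall_locallyConstant {V : Type*} (G : SimpleGraph V) (u : V) :
    G.Connected ↔
      ∀ f : V → Prop, (∀ x y, G.Adj x y → (f x ↔ f y)) → ∀ x, f x ↔ f u := by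
  constructor
  · intro h f hf x
    obtain ⟨p⟩ := h.preconnected x u
    induction p with
    | nil => rfl
    | cons hadj _ ih => exact (hf _ _ hadj).trans ih
  · intro h
    rw [connected_iff_exists_forall_reachable]
    refine ⟨u, fun x => ?_⟩
    exact (h (fun y => G.Reachable u y)
      (fun x y hxy => ⟨fun hx => hx.trans hxy.reachable, fun hy => hy.trans hxy.symm.reachable⟩)
      x).2 (Reachable.refl u)

namespace Ladder

/-- The graph `G` with the edge `xy` added when `c` is true. -/
def addEdge {V : Type*} (G : SimpleGraph V) (c : Bool) (x y : V) : SimpleGraph V :=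
  G ⊔ fromEdgeSet {e | c = true ∧ e = s(x, y)}

theorem addEdge_adj {V : Type*} {G : SimpleGraph V} {c : Bool} {x y : V} (hxy : x ≠ y) {v w : V} :
    (addEdge G c x y).Adj v w ↔
      G.Adj v w ∨ (c = true ∧ (v = x ∧ w = y ∨ v = y ∧ w = x)) := by
  simp only [addEdge, sup_adj, fromEdgeSet_adj, Set.mem_ofPred_eq, Sym2.eq_iff]
  grind

theorem card_edgeSet_addEdge {V : Type*} [Finite V] {G : SimpleGraph V} {x y : V} (hxy : x ≠ y)
    (h : ¬ G.Adj x y) (c : Bool) :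
    Nat.card (addEdge G c x y).edgeSet = Nat.card G.edgeSet + c.toNat := by
  cases c
  · simp [addEdge]
  · have : (addEdge G true x y).edgeSet = insert s(x, y) G.edgeSet := by
      ext e
      induction e with | _ v w
      simp only [mem_edgeSet, addEdge_adj hxy, Set.mem_insert_iff, Sym2.eq_iff, true_and]
      tauto
    rw [Nat.card_coe_set_eq, Nat.card_coe_set_eq, this,
      Set.ncard_insert_of_notMem (by simpa using h) (Set.toFinite _)]
    rfl

/-- The inclusion of the first `n + 1` rungs into `n + 2` rungs. -/
def inclusion (n : ℕ) : Fin (n + 1) × Fin 2 ↪ Fin (n + 2) × Fin 2 :=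
  Fin.castSuccEmb.prodMap (Function.Embedding.refl _)

/-- The vertices of the last rung. -/
def lastVertex (n : ℕ) (i : Fin 2) : Fin (n + 1) × Fin 2 := (Fin.last n, i)

theorem inclusion_ne_lastVertex {n : ℕ} (x : Fin (n + 1) × Fin 2) (i : Fin 2) :
    inclusion n x ≠ lastVertex (n + 1) i := by
  intro h
  exact (Fin.castSucc_lt_last x.1).ne (congrArg Prod.fst h)

theorem exists_inclusion_or_lastVertex {n : ℕ} (x : Fin (n + 2) × Fin 2) :
    (∃ y, x = inclusion n y) ∨ x = lastVertex (n + 1) 0 ∨ x = lastVertex (n + 1) 1 := by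
  obtain ⟨i, j⟩ := x
  induction i using Fin.lastCases with
  | last => right; fin_cases j <;> simp [lastVertex]
  | cast i => exact Or.inl ⟨(i, j), rfl⟩

theorem lastVertex_zero_ne_one {n : ℕ} : lastVertex n 0 ≠ lastVertex n 1 := by
  simp [lastVertex]

/-- The graph obtained from `H` by adding a rung, with the two new rail edges and the new rung
edge present according to `a`, `b` and `r`. -/
def extend {n : ℕ} (H : SimpleGraph (Fin (n + 1) × Fin 2)) (a b r : Bool) :
    SimpleGraph (Fin (n + 2) × Fin 2) :=
  addEdge (addEdge (addEdge (H.map (inclusion n))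
    a (inclusion n (lastVertex n 0)) (lastVertex (n + 1) 0))
    b (inclusion n (lastVertex n 1)) (lastVertex (n + 1) 1))
    r (lastVertex (n + 1) 0) (lastVertex (n + 1) 1)

section Extend

variable {n : ℕ} (H : SimpleGraph (Fin (n + 1) × Fin 2)) (a b r : Bool)

theorem extend_adj (v w : Fin (n + 2) × Fin 2) :
    (extend H a b r).Adj v w ↔
      (((H.map (inclusion n)).Adj v w ∨
      (a = true ∧ (v = inclusion n (lastVertex n 0) ∧ w = lastVertex (n + 1) 0 ∨
        v = lastVertex (n + 1) 0 ∧ w = inclusion n (lastVertex n 0)))) ∨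
      (b = true ∧ (v = inclusion n (lastVertex n 1) ∧ w = lastVertex (n + 1) 1 ∨
        v = lastVertex (n + 1) 1 ∧ w = inclusion n (lastVertex n 1)))) ∨
      (r = true ∧ (v = lastVertex (n + 1) 0 ∧ w = lastVertex (n + 1) 1 ∨
        v = lastVertex (n + 1) 1 ∧ w = lastVertex (n + 1) 0)) := by
  rw [extend, addEdge_adj lastVertex_zero_ne_one, addEdge_adj (inclusion_ne_lastVertex _ _),
    addEdge_adj (inclusion_ne_lastVertex _ _)]

theorem not_map_adj_lastVertex (v : Fin (n + 2) × Fin 2) (i : Fin 2) :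
    ¬ (H.map (inclusion n)).Adj v (lastVertex (n + 1) i) := by
  rw [map_adj]
  rintro ⟨x, y, -, -, h⟩
  exact inclusion_ne_lastVertex _ _ h

theorem card_edgeSet_extend :
    Nat.card (extend H a b r).edgeSet =
      Nat.card H.edgeSet + a.toNat + b.toNat + r.toNat := by
  have hc : Nat.card (H.map (inclusion n)).edgeSet = Nat.card H.edgeSet := by
    rw [show (H.map (inclusion n)).edgeSet = (inclusion n).sym2Map '' H.edgeSet from
      SimpleGraph.edgeSet_map (inclusion n) H]
    exact Nat.card_image_of_injective (inclusion n).sym2Map.injective _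
  have hl := not_map_adj_lastVertex H
  have hn := fun x i => (inclusion_ne_lastVertex (n := n) x i).symm
  rw [extend, card_edgeSet_addEdge lastVertex_zero_ne_one,
    card_edgeSet_addEdge (inclusion_ne_lastVertex _ _),
    card_edgeSet_addEdge (inclusion_ne_lastVertex _ _), hc]
  · exact hl _ _
  · rw [addEdge_adj (inclusion_ne_lastVertex _ _)]
    simp [hl, inclusion_ne_lastVertex, lastVertex_zero_ne_one.symm, -map_adj]
  · rw [addEdge_adj (inclusion_ne_lastVertex _ _), addEdge_adj (inclusion_ne_lastVertex _ _)]
    simp [hl, hn, -map_adj]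

theorem extend_adj_inclusion (x y : Fin (n + 1) × Fin 2) :
    (extend H a b r).Adj (inclusion n x) (inclusion n y) ↔ H.Adj x y := by
  simp [extend_adj, inclusion_ne_lastVertex]

theorem extend_adj_zero :
    (extend H a b r).Adj (inclusion n (lastVertex n 0)) (lastVertex (n + 1) 0) ↔ a = true := by
  simp [extend_adj, inclusion_ne_lastVertex, lastVertex_zero_ne_one]

theorem extend_adj_one :
    (extend H a b r).Adj (inclusion n (lastVertex n 1)) (lastVertex (n + 1) 1) ↔ b = true := by
  simp [extend_adj, inclusion_ne_lastVertex, lastVertex_zero_ne_one.symm]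

theorem extend_adj_rung :
    (extend H a b r).Adj (lastVertex (n + 1) 0) (lastVertex (n + 1) 1) ↔ r = true := by
  have hn := fun x i => (inclusion_ne_lastVertex (n := n) x i).symm
  simp [extend_adj, hn, not_map_adj_lastVertex, lastVertex_zero_ne_one.symm, -map_adj]

/-- A predicate on the vertices of the extended graph is locally constant iff its restriction is
and it respects the added edges. -/
theorem locallyConstant_extend_iff (f : Fin (n + 2) × Fin 2 → Prop) :
    (∀ x y, (extend H a b r).Adj x y → (f x ↔ f y)) ↔
      (∀ x y, H.Adj x y → (f (inclusion n x) ↔ f (inclusion n y))) ∧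
      (a = true → (f (inclusion n (lastVertex n 0)) ↔ f (lastVertex (n + 1) 0))) ∧
      (b = true → (f (inclusion n (lastVertex n 1)) ↔ f (lastVertex (n + 1) 1))) ∧
      (r = true → (f (lastVertex (n + 1) 0) ↔ f (lastVertex (n + 1) 1))) := by
  constructor
  · exact fun h => ⟨fun x y hxy => h _ _ ((extend_adj_inclusion H a b r x y).2 hxy),
      fun ha => h _ _ ((extend_adj_zero H a b r).2 ha),
      fun hb => h _ _ ((extend_adj_one H a b r).2 hb),
      fun hr => h _ _ ((extend_adj_rung H a b r).2 hr)⟩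
  · rintro ⟨h, ha, hb, hr⟩ x y hxy
    rw [extend_adj, map_adj] at hxy
    rcases hxy with
      ((⟨x, y, hxy, rfl, rfl⟩ | ⟨ht, ⟨rfl, rfl⟩ | ⟨rfl, rfl⟩⟩) | ⟨ht, ⟨rfl, rfl⟩ | ⟨rfl, rfl⟩⟩) |
        ⟨ht, ⟨rfl, rfl⟩ | ⟨rfl, rfl⟩⟩
    · exact h x y hxy
    · exact ha ht
    · exact (ha ht).symm
    · exact hb ht
    · exact (hb ht).symm
    · exact hr ht
    · exact (hr ht).symm

theorem exists_extension (g : Fin (n + 1) × Fin 2 → Prop) (p q : Prop) :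
    ∃ f : Fin (n + 2) × Fin 2 → Prop, (∀ x, f (inclusion n x) = g x) ∧
      f (lastVertex (n + 1) 0) = p ∧ f (lastVertex (n + 1) 1) = q := by
  refine ⟨fun x => Fin.lastCases (motive := fun _ => Prop) (if x.2 = 0 then p else q)
    (fun i => g (i, x.2)) x.1, fun x => ?_, ?_, ?_⟩
  · simp [inclusion]
  · simp [lastVertex]
  · simp [lastVertex]

theorem forall_predicate_iff (P : (Fin (n + 1) × Fin 2 → Prop) → Prop → Prop → Prop) :
    (∀ f : Fin (n + 2) × Fin 2 → Prop,
      P (fun x => f (inclusion n x)) (f (lastVertex (n + 1) 0)) (f (lastVertex (n + 1) 1))) ↔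
    ∀ g p q, P g p q := by
  constructor
  · intro h g p q
    obtain ⟨f, hf, rfl, rfl⟩ := exists_extension g p q
    obtain rfl : (fun x => f (inclusion n x)) = g := funext hf
    exact h f
  · exact fun h f => h _ _ _

theorem forall_vertex_iff (P : Fin (n + 2) × Fin 2 → Prop) :
    (∀ x, P x) ↔
      (∀ x, P (inclusion n x)) ∧ P (lastVertex (n + 1) 0) ∧ P (lastVertex (n + 1) 1) := by
  refine ⟨fun h => ⟨fun _ => h _, h _, h _⟩, ?_⟩
  rintro ⟨h, h0, h1⟩ x
  obtain ⟨y, rfl⟩ | rfl | rfl := exists_inclusion_or_lastVertex x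
  exacts [h y, h0, h1]

end Extend

/-- Every vertex is connected to one of the two vertices of the last rung. -/
def ConnectedToLast {n : ℕ} (H : SimpleGraph (Fin (n + 1) × Fin 2)) : Prop :=
  ∀ f : Fin (n + 1) × Fin 2 → Prop, (∀ x y, H.Adj x y → (f x ↔ f y)) →
    (f (lastVertex n 0) ↔ f (lastVertex n 1)) → ∀ x, f x ↔ f (lastVertex n 0)

/-- A spanning forest with two components which separate the vertices of the last rung. -/
def IsSeparatingForest {n : ℕ} (H : SimpleGraph (Fin (n + 1) × Fin 2)) : Prop :=
  ConnectedToLast H ∧ Nat.card H.edgeSet = 2 * n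

theorem isTree_iff {n : ℕ} (H : SimpleGraph (Fin (n + 1) × Fin 2)) :
    H.IsTree ↔ H.Connected ∧ Nat.card H.edgeSet = 2 * n + 1 := by
  rw [isTree_iff_connected_and_card]
  simp only [Nat.card_prod, Nat.card_fin]
  refine and_congr_right fun _ => ?_
  omega

theorem connected_extend_iff {n : ℕ} (H : SimpleGraph (Fin (n + 1) × Fin 2)) (a b r : Bool) :
    (extend H a b r).Connected ↔
      ∀ (g : Fin (n + 1) × Fin 2 → Prop) (p q : Prop),
        ((∀ x y, H.Adj x y → (g x ↔ g y)) ∧ (a = true → (g (lastVertex n 0) ↔ p)) ∧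
          (b = true → (g (lastVertex n 1) ↔ q)) ∧ (r = true → (p ↔ q))) →
        (∀ x, g x ↔ p) ∧ (q ↔ p) := by
  rw [connected_iff_forall_locallyConstant _ (lastVertex (n + 1) 0)]
  simp only [locallyConstant_extend_iff]
  rw [← forall_predicate_iff]
  refine forall_congr' fun f => imp_congr_right fun _ => ?_
  simp only [forall_vertex_iff, true_and]

theorem connectedToLast_extend_iff {n : ℕ} (H : SimpleGraph (Fin (n + 1) × Fin 2))
    (a b r : Bool) :
    ConnectedToLast (extend H a b r) ↔
      ∀ (g : Fin (n + 1) × Fin 2 → Prop) (p q : Prop),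
        ((∀ x y, H.Adj x y → (g x ↔ g y)) ∧ (a = true → (g (lastVertex n 0) ↔ p)) ∧
          (b = true → (g (lastVertex n 1) ↔ q)) ∧ (r = true → (p ↔ q))) → (p ↔ q) →
        (∀ x, g x ↔ p) ∧ (q ↔ p) := by
  unfold ConnectedToLast
  simp only [locallyConstant_extend_iff]
  rw [← forall_predicate_iff]
  refine forall_congr' fun f => imp_congr_right fun _ => imp_congr_right fun _ => ?_
  simp only [forall_vertex_iff, true_and]

theorem ladderGraph_adj {n : ℕ} (x y : Fin n × Fin 2) :
    (ladderGraph n).Adj x y ↔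
      ((x.1.val + 1 = y.1.val ∨ y.1.val + 1 = x.1.val) ∧ x.2 = y.2) ∨ (x.2 ≠ y.2 ∧ x.1 = y.1) := by
  rw [ladderGraph, boxProd_adj, pathGraph_adj, pathGraph_adj]
  have : ∀ i j : Fin 2, (i.val + 1 = j.val ∨ j.val + 1 = i.val) ↔ i ≠ j := by decide
  rw [this]

theorem le_iff_extend {n : ℕ} {A B : SimpleGraph (Fin (n + 2) × Fin 2)} :
    A ≤ B ↔
      (∀ x y, A.Adj (inclusion n x) (inclusion n y) → B.Adj (inclusion n x) (inclusion n y)) ∧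
      (∀ x i, A.Adj (inclusion n x) (lastVertex (n + 1) i) →
        B.Adj (inclusion n x) (lastVertex (n + 1) i)) ∧
      (A.Adj (lastVertex (n + 1) 0) (lastVertex (n + 1) 1) →
        B.Adj (lastVertex (n + 1) 0) (lastVertex (n + 1) 1)) := by
  refine ⟨fun h => ⟨fun _ _ hA => h hA, fun _ _ hA => h hA, fun hA => h hA⟩, ?_⟩
  rintro ⟨h1, h2, h3⟩ x y hA
  obtain ⟨x, rfl⟩ | rfl | rfl := exists_inclusion_or_lastVertex x <;>
  obtain ⟨y, rfl⟩ | rfl | rfl := exists_inclusion_or_lastVertex y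
  · exact h1 _ _ hA
  · exact h2 _ _ hA
  · exact h2 _ _ hA
  · exact (h2 _ _ hA.symm).symm
  · exact absurd rfl hA.ne
  · exact h3 hA
  · exact (h2 _ _ hA.symm).symm
  · exact (h3 hA.symm).symm
  · exact absurd rfl hA.ne

theorem ladderGraph_adj_inclusion {n : ℕ} (x y : Fin (n + 1) × Fin 2) :
    (ladderGraph (n + 2)).Adj (inclusion n x) (inclusion n y) ↔ (ladderGraph (n + 1)).Adj x y := by
  simp [ladderGraph_adj, inclusion]

theorem ladderGraph_adj_lastVertex {n : ℕ} (x : Fin (n + 1) × Fin 2) (i : Fin 2) :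
    (ladderGraph (n + 2)).Adj (inclusion n x) (lastVertex (n + 1) i) ↔ x = lastVertex n i := by
  have := x.1.isLt
  simp only [ladderGraph_adj, inclusion, lastVertex, Prod.ext_iff, Fin.ext_iff,
    Function.Embedding.coe_prodMap, Prod.map_fst, Prod.map_snd, Fin.castSuccEmb_apply,
    Function.Embedding.refl_apply, Fin.val_castSucc, Fin.val_last]
  omega

theorem ladderGraph_adj_rung {n : ℕ} :
    (ladderGraph (n + 1)).Adj (lastVertex n 0) (lastVertex n 1) := by
  simp [ladderGraph_adj, lastVertex]

theorem extend_adj_lastVertex {n : ℕ} (H : SimpleGraph (Fin (n + 1) × Fin 2)) (a b r : Bool)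
    (x : Fin (n + 1) × Fin 2) (i : Fin 2) :
    (extend H a b r).Adj (inclusion n x) (lastVertex (n + 1) i) ↔
      x = lastVertex n i ∧ (if i = 0 then a else b) = true := by
  have h01 := lastVertex_zero_ne_one (n := n + 1)
  fin_cases i <;>
  simp [extend_adj, inclusion_ne_lastVertex, not_map_adj_lastVertex, h01, h01.symm, -map_adj,
    and_comm]

theorem extend_le_ladderGraph_iff {n : ℕ} {H : SimpleGraph (Fin (n + 1) × Fin 2)} {a b r : Bool} :
    extend H a b r ≤ ladderGraph (n + 2) ↔ H ≤ ladderGraph (n + 1) := by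
  rw [le_iff_extend]
  simp only [extend_adj_inclusion, ladderGraph_adj_inclusion, extend_adj_lastVertex,
    ladderGraph_adj_lastVertex, ladderGraph_adj_rung, implies_true, and_true]
  exact ⟨fun h x y => h.1 x y, fun h => ⟨fun x y => @h x y, fun _ _ h => h.1⟩⟩

open Classical in
/-- A subgraph of the ladder is determined by its restriction to the first rungs and by the three
edges meeting the last rung. -/
noncomputable def subgraphEquiv (n : ℕ) :
    {K : SimpleGraph (Fin (n + 2) × Fin 2) // K ≤ ladderGraph (n + 2)} ≃
      (Bool × Bool × Bool) ×
        {H : SimpleGraph (Fin (n + 1) × Fin 2) // H ≤ ladderGraph (n + 1)} where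
  toFun K :=
    ((decide (K.1.Adj (inclusion n (lastVertex n 0)) (lastVertex (n + 1) 0)),
      decide (K.1.Adj (inclusion n (lastVertex n 1)) (lastVertex (n + 1) 1)),
      decide (K.1.Adj (lastVertex (n + 1) 0) (lastVertex (n + 1) 1))),
      ⟨K.1.comap (inclusion n), fun x y h => (ladderGraph_adj_inclusion x y).1 (K.2 h)⟩)
  invFun p := ⟨extend p.2.1 p.1.1 p.1.2.1 p.1.2.2, extend_le_ladderGraph_iff.2 p.2.2⟩
  left_inv := by
    rintro ⟨K, hK⟩
    have key : ∀ x i, K.Adj (inclusion n x) (lastVertex (n + 1) i) → x = lastVertex n i :=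
      fun x i h => (ladderGraph_adj_lastVertex x i).1 (hK h)
    refine Subtype.ext (le_antisymm ?_ ?_) <;>
      refine le_iff_extend.2 ⟨fun x y => ?_, fun x i => ?_, ?_⟩
    · simp [extend_adj_inclusion]
    · rw [extend_adj_lastVertex]
      rintro ⟨rfl, h⟩
      fin_cases i <;> simpa using h
    · simp [extend_adj_rung]
    · simp [extend_adj_inclusion]
    · intro h
      rw [extend_adj_lastVertex]
      obtain rfl := key x i h
      refine ⟨rfl, ?_⟩
      fin_cases i <;> simpa using h
    · simp [extend_adj_rung]
  right_inv := by
    rintro ⟨⟨a, b, r⟩, H, hH⟩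
    have : (extend H a b r).comap (inclusion n) = H := by
      ext x y
      exact extend_adj_inclusion H a b r x y
    simp [extend_adj_zero, extend_adj_one, extend_adj_rung, this]

/-- The number of subgraphs of a ladder satisfying `P`. -/
noncomputable def countSubgraphs (n : ℕ) (P : SimpleGraph (Fin n × Fin 2) → Prop) : ℕ :=
  Nat.card {H : SimpleGraph (Fin n × Fin 2) // H ≤ ladderGraph n ∧ P H}

theorem countSubgraphs_succ (n : ℕ) (P : SimpleGraph (Fin (n + 2) × Fin 2) → Prop) :
    countSubgraphs (n + 2) P =
      ∑ c : Bool × Bool × Bool, countSubgraphs (n + 1) fun H => P (extend H c.1 c.2.1 c.2.2) := by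
  let Q (c : Bool × Bool × Bool) (H : SimpleGraph (Fin (n + 1) × Fin 2)) : Prop :=
    P (extend H c.1 c.2.1 c.2.2)
  have e : {K // K ≤ ladderGraph (n + 2) ∧ P K} ≃
      Σ c : Bool × Bool × Bool, {H // H ≤ ladderGraph (n + 1) ∧ Q c H} :=
    calc
      _ ≃ {K : {K // K ≤ ladderGraph (n + 2)} // P K.1} :=
        (Equiv.subtypeSubtypeEquivSubtypeInter _ _).symm
      _ ≃ {p : (Bool × Bool × Bool) × {H // H ≤ ladderGraph (n + 1)} // Q p.1 p.2.1} :=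
        ((subgraphEquiv n).symm.subtypeEquiv fun _ => Iff.rfl).symm
      _ ≃ Σ c : Bool × Bool × Bool, {H : {H // H ≤ ladderGraph (n + 1)} // Q c H.1} :=
        { toFun := fun p => ⟨p.1.1, p.1.2, p.2⟩
          invFun := fun p => ⟨(p.1, p.2.1), p.2.2⟩ }
      _ ≃ _ := Equiv.sigmaCongrRight fun c => Equiv.subtypeSubtypeEquivSubtypeInter _ _
  rw [countSubgraphs, Nat.card_congr e, Nat.card_sigma]
  rfl

theorem countSubgraphs_false (n : ℕ) : countSubgraphs n (fun _ => False) = 0 := by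
  simp [countSubgraphs]

theorem le_card_edgeSet {n : ℕ} {H : SimpleGraph (Fin (n + 1) × Fin 2)} (h : H.Connected) :
    2 * n + 1 ≤ Nat.card H.edgeSet := by
  have := h.card_vert_le_card_edgeSet_add_one
  simp only [Nat.card_prod, Nat.card_fin] at this
  omega

theorem connected_iff {n : ℕ} (H : SimpleGraph (Fin (n + 1) × Fin 2)) (i : Fin 2) :
    H.Connected ↔ ∀ g : Fin (n + 1) × Fin 2 → Prop,
      (∀ x y, H.Adj x y → (g x ↔ g y)) → ∀ x, g x ↔ g (lastVertex n i) :=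
  connected_iff_forall_locallyConstant H _

theorem connected_extend_all {n : ℕ} (H : SimpleGraph (Fin (n + 1) × Fin 2)) :
    (extend H true true true).Connected ↔ ConnectedToLast H := by
  rw [connected_extend_iff]
  constructor
  · intro h g hg h01 x
    exact (h g _ _ ⟨hg, fun _ => Iff.rfl, fun _ => h01.symm, fun _ => Iff.rfl⟩).1 x
  · rintro h g p q ⟨hg, ha, hb, hr⟩
    have ha := ha rfl
    have hb := hb rfl
    have hr := hr rfl
    exact ⟨fun x => (h g hg (by tauto) x).trans ha, hr.symm⟩

theorem exists_respecting_two {a b r : Bool} (h : a.toNat + b.toNat + r.toNat = 2) (P Q : Prop) :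
    ∃ p q : Prop, (a = true → (P ↔ p)) ∧ (b = true → (Q ↔ q)) ∧ (r = true → (p ↔ q)) := by
  by_cases ha : a = true
  · by_cases hb : b = true
    · refine ⟨P, Q, fun _ => Iff.rfl, fun _ => Iff.rfl, fun hr => ?_⟩
      subst ha hb hr
      exact absurd h (by decide)
    · exact ⟨P, P, fun _ => Iff.rfl, fun h => absurd h hb, fun _ => Iff.rfl⟩
  · exact ⟨Q, Q, fun h => absurd h ha, fun _ => Iff.rfl, fun _ => Iff.rfl⟩

theorem iff_of_respecting_two {a b r : Bool} (h : a.toNat + b.toNat + r.toNat = 2)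
    {P Q p q : Prop} (hPQ : Q ↔ P) (ha : a = true → (P ↔ p)) (hb : b = true → (Q ↔ q))
    (hr : r = true → (p ↔ q)) : (P ↔ p) ∧ (q ↔ p) := by
  cases a
  · have hb := hb (by revert h; cases b <;> cases r <;> decide)
    have hr := hr (by revert h; cases b <;> cases r <;> decide)
    tauto
  · have ha := ha rfl
    cases b
    · have hr := hr (by revert h; cases r <;> decide)
      tauto
    · have hb := hb rfl
      tauto

theorem exists_respecting_of_le_one {a b r : Bool} (h : a.toNat + b.toNat + r.toNat ≤ 1) :
    ∃ p q : Prop, ((a = true → (True ↔ p)) ∧ (b = true → (True ↔ q)) ∧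
      (r = true → (p ↔ q))) ∧ ¬ (p ∧ q) := by
  cases a
  · cases b
    · exact ⟨False, False, by simp⟩
    · cases r
      · exact ⟨False, True, by simp⟩
      · exact absurd h (by decide)
  · cases b
    · cases r
      · exact ⟨True, False, by simp⟩
      · exact absurd h (by decide)
    · exact absurd h (by cases r <;> decide)

theorem connected_extend_two {n : ℕ} (H : SimpleGraph (Fin (n + 1) × Fin 2)) {a b r : Bool}
    (h : a.toNat + b.toNat + r.toNat = 2) :
    (extend H a b r).Connected ↔ H.Connected := by
  rw [connected_extend_iff]
  constructor
  · intro hc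
    rw [connected_iff H 0]
    intro g hg x
    obtain ⟨p, q, hpq⟩ := exists_respecting_two h (g (lastVertex n 0)) (g (lastVertex n 1))
    have := (hc g p q ⟨hg, hpq⟩).1
    exact (this x).trans (this _).symm
  · rintro hc g p q ⟨hg, ha, hb, hr⟩
    have h0 := (connected_iff H 0).1 hc g hg
    have := iff_of_respecting_two h (h0 (lastVertex n 1)) ha hb hr
    exact ⟨fun x => (h0 x).trans this.1, this.2⟩

theorem not_connected_extend {n : ℕ} (H : SimpleGraph (Fin (n + 1) × Fin 2)) {a b r : Bool}
    (h : a.toNat + b.toNat + r.toNat ≤ 1) :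
    ¬ (extend H a b r).Connected := by
  rw [connected_extend_iff]
  intro hc
  obtain ⟨p, q, hpq, hne⟩ := exists_respecting_of_le_one h
  have := hc (fun _ => True) p q ⟨fun _ _ _ => Iff.rfl, hpq⟩
  have hp : p := (this.1 (lastVertex n 0)).1 trivial
  exact hne ⟨hp, this.2.2 hp⟩

theorem connectedToLast_extend_both {n : ℕ} (H : SimpleGraph (Fin (n + 1) × Fin 2)) (r : Bool) :
    ConnectedToLast (extend H true true r) ↔ ConnectedToLast H := by
  rw [connectedToLast_extend_iff]
  constructor
  · intro h g hg h01 x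
    exact (h g _ _ ⟨hg, fun _ => Iff.rfl, fun _ => h01.symm, fun _ => Iff.rfl⟩ Iff.rfl).1 x
  · rintro h g p q ⟨hg, ha, hb, -⟩ hr
    have ha := ha rfl
    have hb := hb rfl
    exact ⟨fun x => (h g hg (by tauto) x).trans ha, hr.symm⟩

theorem connectedToLast_extend_one {n : ℕ} (H : SimpleGraph (Fin (n + 1) × Fin 2)) {a b : Bool}
    (h : a.toNat + b.toNat = 1) (r : Bool) :
    ConnectedToLast (extend H a b r) ↔ H.Connected := by
  rw [connectedToLast_extend_iff]
  constructor
  · intro hc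
    rw [connected_iff H 0]
    intro g hg x
    obtain ⟨p, hpa, hpb⟩ : ∃ p : Prop, (a = true → (g (lastVertex n 0) ↔ p)) ∧
        (b = true → (g (lastVertex n 1) ↔ p)) := by
      cases a
      · exact ⟨g (lastVertex n 1), fun h => absurd h Bool.false_ne_true, fun _ => Iff.rfl⟩
      · cases b
        · exact ⟨g (lastVertex n 0), fun _ => Iff.rfl, fun h => absurd h Bool.false_ne_true⟩
        · exact absurd h (by decide)
    have := (hc g p p ⟨hg, hpa, hpb, fun _ => Iff.rfl⟩ Iff.rfl).1
    exact (this x).trans (this _).symm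
  · rintro hc g p q ⟨hg, ha, hb, -⟩ hr
    have h0 := (connected_iff H 0).1 hc g hg
    have h1 := h0 (lastVertex n 1)
    have : g (lastVertex n 0) ↔ p := by
      cases a
      · cases b
        · exact absurd h (by decide)
        · exact h1.symm.trans ((hb rfl).trans hr.symm)
      · exact ha rfl
    exact ⟨fun x => (h0 x).trans this, hr.symm⟩

theorem not_connectedToLast_extend {n : ℕ} (H : SimpleGraph (Fin (n + 1) × Fin 2)) (r : Bool) :
    ¬ ConnectedToLast (extend H false false r) := by
  rw [connectedToLast_extend_iff]
  intro hc
  have := hc (fun _ => True) False False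
  simp_all

theorem isTree_extend_all {n : ℕ} (H : SimpleGraph (Fin (n + 1) × Fin 2)) :
    (extend H true true true).IsTree ↔ IsSeparatingForest H := by
  rw [isTree_iff, connected_extend_all, card_edgeSet_extend, IsSeparatingForest]
  simp only [Bool.toNat_true]
  exact and_congr_right fun _ => by omega

theorem isTree_extend_two {n : ℕ} (H : SimpleGraph (Fin (n + 1) × Fin 2)) {a b r : Bool}
    (h : a.toNat + b.toNat + r.toNat = 2) :
    (extend H a b r).IsTree ↔ H.IsTree := by
  rw [isTree_iff, isTree_iff, connected_extend_two H h, card_edgeSet_extend]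
  exact and_congr_right fun _ => by omega

theorem not_isTree_extend {n : ℕ} (H : SimpleGraph (Fin (n + 1) × Fin 2)) {a b r : Bool}
    (h : a.toNat + b.toNat + r.toNat ≤ 1) :
    ¬ (extend H a b r).IsTree :=
  fun ht => not_connected_extend H h ht.connected

theorem isSeparatingForest_extend_both {n : ℕ} (H : SimpleGraph (Fin (n + 1) × Fin 2)) :
    IsSeparatingForest (extend H true true false) ↔ IsSeparatingForest H := by
  rw [IsSeparatingForest, connectedToLast_extend_both, card_edgeSet_extend, IsSeparatingForest]
  simp only [Bool.toNat_true, Bool.toNat_false]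
  exact and_congr_right fun _ => by omega

theorem isSeparatingForest_extend_one {n : ℕ} (H : SimpleGraph (Fin (n + 1) × Fin 2))
    {a b : Bool} (h : a.toNat + b.toNat = 1) :
    IsSeparatingForest (extend H a b false) ↔ H.IsTree := by
  rw [IsSeparatingForest, connectedToLast_extend_one H h, card_edgeSet_extend, isTree_iff]
  simp only [Bool.toNat_false]
  exact and_congr_right fun _ => by omega

theorem not_isSeparatingForest_extend_rung {n : ℕ} (H : SimpleGraph (Fin (n + 1) × Fin 2))
    (a b : Bool) : ¬ IsSeparatingForest (extend H a b true) := by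
  rintro ⟨hc, hcard⟩
  have h : (extend H a b true).Connected := by
    rw [connected_iff _ 0]
    exact fun f hf => hc f hf (hf _ _ ((extend_adj_rung H a b true).2 rfl))
  have := le_card_edgeSet h
  omega

theorem not_isSeparatingForest_extend_false {n : ℕ} (H : SimpleGraph (Fin (n + 1) × Fin 2))
    (r : Bool) : ¬ IsSeparatingForest (extend H false false r) :=
  fun h => not_connectedToLast_extend H r h.1

theorem countSubgraphs_tree_succ (n : ℕ) :
    countSubgraphs (n + 2) IsTree =
      3 * countSubgraphs (n + 1) IsTree + countSubgraphs (n + 1) IsSeparatingForest := by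
  rw [countSubgraphs_succ]
  simp [Fintype.sum_prod_type, isTree_extend_all, isTree_extend_two, not_isTree_extend,
    countSubgraphs_false]
  ring

theorem countSubgraphs_forest_succ (n : ℕ) :
    countSubgraphs (n + 2) IsSeparatingForest =
      2 * countSubgraphs (n + 1) IsTree + countSubgraphs (n + 1) IsSeparatingForest := by
  rw [countSubgraphs_succ]
  simp [Fintype.sum_prod_type, isSeparatingForest_extend_both, isSeparatingForest_extend_one,
    not_isSeparatingForest_extend_rung, not_isSeparatingForest_extend_false, countSubgraphs_false]
  ring

theorem countSubgraphs_eq_one {n : ℕ} {P : SimpleGraph (Fin n × Fin 2) → Prop}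
    {K : SimpleGraph (Fin n × Fin 2)} (hK : K ≤ ladderGraph n)
    (h : ∀ H ≤ ladderGraph n, P H ↔ H = K) : countSubgraphs n P = 1 := by
  rw [countSubgraphs, Nat.card_eq_one_iff_unique]
  exact ⟨⟨fun A B => Subtype.ext (((h A A.2.1).1 A.2.2).trans ((h B B.2.1).1 B.2.2).symm)⟩,
    ⟨⟨K, hK, (h K hK).2 rfl⟩⟩⟩

theorem eq_lastVertex_zero (x : Fin 1 × Fin 2) : x = lastVertex 0 0 ∨ x = lastVertex 0 1 := by
  revert x
  decide

theorem connectedToLast_zero (H : SimpleGraph (Fin 1 × Fin 2)) : ConnectedToLast (n := 0) H := by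
  intro f _ h01 x
  obtain rfl | rfl := eq_lastVertex_zero x
  exacts [Iff.rfl, h01.symm]

theorem connected_ladderGraph_one : (ladderGraph 1).Connected := by
  rw [connected_iff (n := 0) _ 0]
  exact fun f hf => connectedToLast_zero _ f hf (hf _ _ (ladderGraph_adj_rung (n := 0)))

theorem eq_bot_or_eq_ladderGraph_one {H : SimpleGraph (Fin 1 × Fin 2)} (h : H ≤ ladderGraph 1) :
    H = ⊥ ∨ H = ladderGraph 1 := by
  by_cases hH : H.Adj (lastVertex 0 0) (lastVertex 0 1)
  · right
    refine le_antisymm h fun x y hxy => ?_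
    obtain rfl | rfl := eq_lastVertex_zero x <;> obtain rfl | rfl := eq_lastVertex_zero y
    exacts [absurd rfl hxy.ne, hH, hH.symm, absurd rfl hxy.ne]
  · left
    refine le_bot_iff.1 fun x y hxy => ?_
    obtain rfl | rfl := eq_lastVertex_zero x <;> obtain rfl | rfl := eq_lastVertex_zero y
    exacts [hxy.ne rfl, hH hxy, hH hxy.symm, hxy.ne rfl]

theorem countSubgraphs_tree_one : countSubgraphs 1 IsTree = 1 := by
  refine countSubgraphs_eq_one le_rfl fun H hH => ⟨fun h => ?_, ?_⟩
  · refine (eq_bot_or_eq_ladderGraph_one hH).resolve_left ?_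
    rintro rfl
    simpa using le_card_edgeSet (n := 0) h.connected
  · rintro rfl
    exact ⟨connected_ladderGraph_one, IsAcyclic.of_card_le_two (by simp)⟩

theorem countSubgraphs_forest_one : countSubgraphs 1 (IsSeparatingForest (n := 0)) = 1 := by
  refine countSubgraphs_eq_one bot_le fun H hH => ⟨fun h => ?_, ?_⟩
  · refine (eq_bot_or_eq_ladderGraph_one hH).resolve_right ?_
    rintro rfl
    have h1 := le_card_edgeSet (n := 0) connected_ladderGraph_one
    have h2 := h.2
    omega
  · rintro rfl
    exact ⟨connectedToLast_zero _, by simp⟩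

theorem spanningTreeCount_ladderGraph (n : ℕ) :
    spanningTreeCount (ladderGraph n) = countSubgraphs n IsTree := rfl

end Ladder

/-- The numbers `bₙ` of spanning trees of ladders satisfy `b₁ = 1`, `b₂ = 4` and
`b_{n+1} = 4 bₙ − b_{n−1}`. -/
theorem spanningTreeCount_ladderGraph_recurrence :
    spanningTreeCount (ladderGraph 1) = 1 ∧
    spanningTreeCount (ladderGraph 2) = 4 ∧
    ∀ n : ℕ, 2 ≤ n →
      (spanningTreeCount (ladderGraph (n + 1)) : ℤ) =
        4 * spanningTreeCount (ladderGraph n) - spanningTreeCount (ladderGraph (n - 1)) := by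
  simp only [Ladder.spanningTreeCount_ladderGraph]
  refine ⟨Ladder.countSubgraphs_tree_one, ?_, fun n hn => ?_⟩
  · rw [Ladder.countSubgraphs_tree_succ 0, Ladder.countSubgraphs_tree_one,
      Ladder.countSubgraphs_forest_one]
  · obtain ⟨m, rfl⟩ := Nat.exists_eq_add_of_le' hn
    have h1 := Ladder.countSubgraphs_tree_succ m
    have h2 := Ladder.countSubgraphs_forest_succ m
    have h3 : Ladder.countSubgraphs (m + 2 + 1) SimpleGraph.IsTree = _ :=
      Ladder.countSubgraphs_tree_succ (m + 1)
    rw [Nat.add_sub_cancel_right (m + 1) 1, h3, h1, h2]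
    push_cast
    ring
end

section
/- Let cₙ denote the number of spanning trees of the wheel graph Φₙ (for n ≥ 3). Then for every n ≥ 5, c_{n+1} = 4·cₙ − 4·c_{n−1} + c_{n−2}. -/
/-- The wheel graph `Φₙ` on `n + 1` vertices: the hub is vertex `0`, the cycle
vertices `1, …, n` are joined consecutively and `n` is joined back to `1`, and the
hub is joined to every cycle vertex. -/
def wheelGraph (n : ℕ) : SimpleGraph (Fin (n + 1)) :=
  SimpleGraph.fromRel
    (fun i j => i = 0 ∨ (i : ℕ) + 1 = (j : ℕ) ∨ ((i : ℕ) = n ∧ (j : ℕ) = 1))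

section ParentMaps

variable {V : Type*}

/-- A map sending each vertex other than `r` to one of its neighbours, fixing `r`, and whose
iterates lead every vertex to `r`: a spanning tree presented by its orientation towards `r`. -/
structure IsParentMap_s9 (G : SimpleGraph V) (r : V) (p : V → V) : Prop where
  map_root : p r = r
  adj : ∀ v, v ≠ r → G.Adj v (p v)
  exists_iterate_eq : ∀ v, ∃ k, p^[k] v = r

/-- The graph joining each vertex to its image. -/
def functionalGraph (p : V → V) : SimpleGraph V :=
  SimpleGraph.fromRel fun u v => p u = v

theorem functionalGraph_adj {p : V → V} {u v : V} :
    (functionalGraph p).Adj u v ↔ u ≠ v ∧ (p u = v ∨ p v = u) :=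
  SimpleGraph.fromRel_adj _ _ _

namespace IsParentMap_s9

variable {G : SimpleGraph V} {r : V} {p q : V → V}

theorem apply_ne_s9 (hp : IsParentMap_s9 G r p) {v : V} (hv : v ≠ r) : p v ≠ v :=
  (hp.adj v hv).ne'

theorem root_mem (hp : IsParentMap_s9 G r p) {S : Set V} (hS : ∀ v ∈ S, p v ∈ S) {v : V}
    (hv : v ∈ S) : r ∈ S := by
  obtain ⟨k, hk⟩ := hp.exists_iterate_eq v
  exact hk ▸ Set.MapsTo.iterate hS k hv

theorem apply_apply_ne_s9 (hp : IsParentMap_s9 G r p) {v : V} (hv : v ≠ r) : p (p v) ≠ v := by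
  intro h
  have hr : r ∈ ({v, p v} : Set V) := hp.root_mem (by simp [h]) (.inl rfl)
  grind [hp.map_root]

theorem functionalGraph_le (hp : IsParentMap_s9 G r p) : functionalGraph p ≤ G := by
  intro u v huv
  obtain ⟨hne, rfl | rfl⟩ := functionalGraph_adj.1 huv
  · exact hp.adj u fun h => hne (by rw [h, hp.map_root])
  · exact (hp.adj v fun h => hne (by rw [h, hp.map_root])).symm

theorem reachable_root (hp : IsParentMap_s9 G r p) (v : V) : (functionalGraph p).Reachable v r := by
  obtain ⟨k, hk⟩ := hp.exists_iterate_eq v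
  induction k generalizing v with
  | zero => exact hk ▸ .rfl
  | succ k ih =>
    refine .trans ?_ (ih (p v) hk)
    by_cases h : v = p v
    · exact h ▸ .rfl
    · exact (functionalGraph_adj.2 ⟨h, .inl rfl⟩).reachable

theorem connected (hp : IsParentMap_s9 G r p) : (functionalGraph p).Connected :=
  have : Nonempty V := ⟨r⟩
  ⟨fun u v => (hp.reachable_root u).trans (hp.reachable_root v).symm⟩

theorem isTree [Finite V] (hp : IsParentMap_s9 G r p) : (functionalGraph p).IsTree := by
  refine SimpleGraph.isTree_iff_connected_and_card.2
    ⟨hp.connected, le_antisymm ?_ hp.connected.card_vert_le_card_edgeSet_add_one⟩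
  have hsub : (functionalGraph p).edgeSet ⊆ (fun v => s(v, p v)) '' {r}ᶜ := by
    intro e
    induction e with | _ u v
    intro (huv : (functionalGraph p).Adj u v)
    obtain ⟨hne, rfl | rfl⟩ := functionalGraph_adj.1 huv
    · exact ⟨u, fun h => hne (by rw [h, hp.map_root]), rfl⟩
    · exact ⟨v, fun h => hne (by rw [h, hp.map_root]), Sym2.eq_swap⟩
  have h1 : Nat.card (functionalGraph p).edgeSet ≤ ({r}ᶜ : Set V).ncard := by
    rw [Nat.card_coe_set_eq]
    exact (Set.ncard_le_ncard hsub (Set.toFinite _)).trans (Set.ncard_image_le (Set.toFinite _))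
  have h2 := Set.ncard_add_ncard_compl {r}
  rw [Set.ncard_singleton] at h2
  omega

theorem eq_of_functionalGraph_eq (hp : IsParentMap_s9 G r p) (hq : IsParentMap_s9 G r q)
    (h : functionalGraph p = functionalGraph q) : p = q := by
  by_contra hne
  obtain ⟨v, hv⟩ := Function.ne_iff.1 hne
  refine hp.root_mem (S := {v | p v ≠ q v}) (fun u hu => ?_) hv (by rw [hp.map_root, hq.map_root])
  have hur : u ≠ r := by
    rintro rfl
    exact hu (by rw [hp.map_root, hq.map_root])
  have hadj : (functionalGraph q).Adj u (p u) :=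
    h ▸ functionalGraph_adj.2 ⟨(hp.apply_ne_s9 hur).symm, .inl rfl⟩
  obtain ⟨-, h1 | h1⟩ := functionalGraph_adj.1 hadj
  · exact absurd h1.symm hu
  · simpa [h1] using hp.apply_apply_ne_s9 hur

end IsParentMap_s9

theorem SimpleGraph.IsTree.exists_isParentMap {G T : SimpleGraph V} (hT : T.IsTree) (hle : T ≤ G)
    (r : V) : ∃ p, IsParentMap_s9 G r p ∧ functionalGraph p = T := by
  classical
  have hstep (v : V) (hv : v ≠ r) : ∃ w, T.Adj v w ∧ T.dist w r < T.dist v r := by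
    obtain ⟨W, hW⟩ := hT.connected.exists_walk_length_eq_dist v r
    cases W with
    | nil => exact absurd rfl hv
    | cons h W =>
      refine ⟨_, h, (SimpleGraph.dist_le W).trans_lt ?_⟩
      rw [← hW, SimpleGraph.Walk.length_cons]
      exact Nat.lt_succ_self _
  choose! f hf using hstep
  let p : V → V := fun v => if v = r then r else f v
  have hpT : ∀ v, v ≠ r → T.Adj v (p v) := fun v hv => by
    simpa [p, hv] using (hf v hv).1
  have hp : IsParentMap_s9 T r p := by
    refine ⟨by simp [p], hpT, fun v => ?_⟩
    induction hd : T.dist v r using Nat.strong_induction_on generalizing v with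
    | _ d ih =>
      by_cases hv : v = r
      · exact ⟨0, hv⟩
      · obtain ⟨k, hk⟩ := ih _ (hd ▸ (hf v hv).2) (f v) rfl
        exact ⟨k + 1, by simpa [p, hv] using hk⟩
  refine ⟨p, ⟨hp.map_root, fun v hv => hle (hpT v hv), hp.exists_iterate_eq⟩, ?_⟩
  exact ((SimpleGraph.isTree_iff_minimal_connected.1 hT).eq_of_ge hp.connected
    hp.functionalGraph_le).symm

theorem spanningTreeCount_eq_card_isParentMap [Finite V] (G : SimpleGraph V) (r : V) :
    spanningTreeCount G = Nat.card {p : V → V // IsParentMap_s9 G r p} := by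
  refine (Nat.card_eq_of_bijective
    (fun p => ⟨functionalGraph p.1, p.2.functionalGraph_le, p.2.isTree⟩) ⟨?_, ?_⟩).symm
  · intro p q h
    exact Subtype.ext (p.2.eq_of_functionalGraph_eq q.2 (congrArg Subtype.val h))
  · rintro ⟨T, hle, hT⟩
    obtain ⟨p, hp, h⟩ := hT.exists_isParentMap hle r
    exact ⟨⟨p, hp⟩, Subtype.ext h⟩

end ParentMaps

section CyclicWords

open Finset Matrix

variable {α R : Type*} [Fintype α] [DecidableEq α] [CommSemiring R]

theorem sum_prod_path_mul (M : Matrix α α R) (m : ℕ) (g : α → α → R) :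
    ∑ c : Fin (m + 1) → α, (∏ i : Fin m, M (c i.castSucc) (c i.succ)) * g (c 0) (c (Fin.last m)) =
      ∑ a, ∑ b, (M ^ m) a b * g a b := by
  induction m generalizing g with
  | zero =>
    rw [← (Equiv.funUnique (Fin 1) α).symm.sum_comp]
    simp [Matrix.one_apply]
  | succ m ih =>
    rw [← (Fin.consEquiv fun _ => α).sum_comp, Fintype.sum_prod_type]
    refine sum_congr rfl fun a _ => ?_
    have h := ih fun x y => M a x * g a y
    simp only [Fin.consEquiv_apply, Fin.prod_univ_succ, Fin.castSucc_zero, Fin.cons_zero,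
      Fin.cons_succ, Fin.castSucc_succ, ← Fin.succ_last]
    simp only [pow_succ', Matrix.mul_apply, sum_mul]
    rw [sum_comm]
    convert h using 2 with c
    · ring
    · exact sum_congr rfl fun _ _ => by ring

theorem sum_prod_cycle (M : Matrix α α R) (m : ℕ) :
    ∑ c : Fin (m + 1) → α, ∏ i, M (c i) (c (i + 1)) = (M ^ (m + 1)).trace := by
  have h := sum_prod_path_mul M m fun a b => M b a
  simp only [Matrix.trace, Matrix.diag_apply, pow_succ, Matrix.mul_apply]
  rw [← h]
  refine sum_congr rfl fun c _ => ?_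
  rw [Fin.prod_univ_castSucc]
  simp

end CyclicWords

section Wheel

theorem wheelGraph_adj_succ {m : ℕ} (hm : 2 ≤ m) (i : Fin (m + 1)) (y : Fin (m + 2)) :
    (wheelGraph (m + 1)).Adj i.succ y ↔ y = 0 ∨ y = (i - 1).succ ∨ y = (i + 1).succ := by
  rw [wheelGraph, SimpleGraph.fromRel_adj]
  induction y using Fin.cases with
  | zero => simp
  | succ j =>
    simp only [ne_eq, Fin.succ_inj, eq_sub_iff_add_eq, Fin.succ_ne_zero, false_or]
    simp only [Fin.ext_iff, Fin.val_succ, Fin.val_add_one, Fin.val_last]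
    split_ifs <;> omega

/-- The self-map of the wheel sending each cycle vertex to the hub, to its predecessor or to its
successor, according to the letter `0`, `1` or `2` of the word `c`. -/
def wheelMap {m : ℕ} (c : Fin (m + 1) → Fin 3) : Fin (m + 2) → Fin (m + 2) :=
  Fin.cons 0 fun i => ![0, (i - 1).succ, (i + 1).succ] (c i)

/-- The words whose map follows the cycle neither back and forth nor all the way round. -/
def IsTreeWord {m : ℕ} (c : Fin (m + 1) → Fin 3) : Prop :=
  (∀ i, ¬(c i = 2 ∧ c (i + 1) = 1)) ∧ c ≠ (fun _ => 1) ∧ c ≠ fun _ => 2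

variable {m : ℕ} {c : Fin (m + 1) → Fin 3}

theorem wheelMap_zero : wheelMap c 0 = 0 := rfl

theorem wheelMap_succ (i : Fin (m + 1)) :
    wheelMap c i.succ = ![0, (i - 1).succ, (i + 1).succ] (c i) := rfl

theorem Fin.forall_of_add_one {P : Fin (m + 1) → Prop} (h : ∀ i, P i → P (i + 1))
    {i : Fin (m + 1)} (hi : P i) (j : Fin (m + 1)) : P j := by
  have h0 : P 0 := by
    have : ∀ k : Fin (m + 1), P (i + k) := by
      intro k
      induction k using Fin.induction with
      | zero => simpa
      | succ k ih => simpa [← Fin.coeSucc_eq_succ, add_assoc] using h _ ih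
    simpa using this (-i)
  induction j using Fin.induction with
  | zero => exact h0
  | succ k ih => simpa [← Fin.coeSucc_eq_succ] using h _ ih

theorem Fin.forall_of_sub_one {P : Fin (m + 1) → Prop} (h : ∀ i, P i → P (i - 1))
    {i : Fin (m + 1)} (hi : P i) (j : Fin (m + 1)) : P j := by
  have := Fin.forall_of_add_one (P := fun k => P (-k))
    (fun k hk => by simpa [sub_eq_add_neg, add_comm] using h _ hk) (i := -i) (by simpa) (-j)
  simpa using this

theorem IsTreeWord.exists_iterate_eq (hc : IsTreeWord c) (v : Fin (m + 2)) :
    ∃ k, (wheelMap c)^[k] v = 0 := by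
  by_contra hv
  have hstep (u : Fin (m + 2)) (hu : ¬∃ k, (wheelMap c)^[k] u = 0) :
      ¬∃ k, (wheelMap c)^[k] (wheelMap c u) = 0 := fun ⟨k, hk⟩ => hu ⟨k + 1, hk⟩
  have hne (i : Fin (m + 1)) (hi : ¬∃ k, (wheelMap c)^[k] i.succ = 0) : c i ≠ 0 := fun h =>
    hi ⟨1, by simp [wheelMap_succ, h]⟩
  induction v using Fin.cases with
  | zero => exact hv ⟨0, rfl⟩
  | succ i =>
    have h012 : ∀ x : Fin 3, x = 0 ∨ x = 1 ∨ x = 2 := by decide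
    rcases h012 (c i) with h | h | h
    · exact hne i hv h
    · refine hc.2.1 (funext fun j => (Fin.forall_of_sub_one
        (P := fun j => c j = 1 ∧ ¬∃ k, (wheelMap c)^[k] j.succ = 0) ?_ ⟨h, hv⟩ j).1)
      rintro j ⟨hj, hj'⟩
      have hnext : ¬∃ k, (wheelMap c)^[k] (j - 1).succ = 0 := by
        simpa [wheelMap_succ, hj] using hstep _ hj'
      have := hc.1 (j - 1)
      rw [sub_add_cancel] at this
      have := h012 (c (j - 1))
      have := hne _ hnext
      exact ⟨by tauto, hnext⟩
    · refine hc.2.2 (funext fun j => (Fin.forall_of_add_one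
        (P := fun j => c j = 2 ∧ ¬∃ k, (wheelMap c)^[k] j.succ = 0) ?_ ⟨h, hv⟩ j).1)
      rintro j ⟨hj, hj'⟩
      have hnext : ¬∃ k, (wheelMap c)^[k] (j + 1).succ = 0 := by
        simpa [wheelMap_succ, hj] using hstep _ hj'
      have := hc.1 j
      have := h012 (c (j + 1))
      have := hne _ hnext
      exact ⟨by tauto, hnext⟩

theorem isParentMap_wheelMap_iff (hm : 2 ≤ m) :
    IsParentMap_s9 (wheelGraph (m + 1)) 0 (wheelMap c) ↔ IsTreeWord c := by
  refine ⟨fun h => ⟨?_, ?_, ?_⟩, fun hc => ⟨rfl, fun v hv => ?_, hc.exists_iterate_eq⟩⟩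
  · rintro i ⟨h1, h2⟩
    refine h.apply_apply_ne_s9 (Fin.succ_ne_zero i) ?_
    simp [wheelMap_succ, h1, h2]
  · rintro rfl
    exact h.root_mem (S := {0}ᶜ) (Fin.cases (by simp) fun i _ => by simp [wheelMap_succ])
      (Fin.succ_ne_zero 0) rfl
  · rintro rfl
    exact h.root_mem (S := {0}ᶜ) (Fin.cases (by simp) fun i _ => by simp [wheelMap_succ])
      (Fin.succ_ne_zero 0) rfl
  · obtain ⟨i, rfl⟩ := Fin.exists_succ_eq.2 hv
    rw [wheelGraph_adj_succ hm, wheelMap_succ]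
    generalize c i = x
    fin_cases x <;> simp

theorem wheelMap_injective (hm : 2 ≤ m) : Function.Injective (wheelMap (m := m)) := by
  intro c d h
  funext i
  have hi := congrFun h i.succ
  have hne : i - 1 ≠ i + 1 := by
    rw [ne_eq, sub_eq_iff_eq_add]
    simp only [Fin.ext_iff, Fin.val_add_one, Fin.val_last]
    split_ifs <;> omega
  rw [wheelMap_succ, wheelMap_succ] at hi
  generalize c i = x at *
  generalize d i = y at *
  fin_cases x <;> fin_cases y <;> simp_all [eq_comm (a := (0 : Fin (m + 2))), Fin.succ_ne_zero]

theorem exists_wheelMap_eq (hm : 2 ≤ m) {p : Fin (m + 2) → Fin (m + 2)}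
    (hp : IsParentMap_s9 (wheelGraph (m + 1)) 0 p) : ∃ c, wheelMap c = p := by
  have h (i : Fin (m + 1)) : ∃ x : Fin 3, ![0, (i - 1).succ, (i + 1).succ] x = p i.succ := by
    rcases (wheelGraph_adj_succ hm i _).1 (hp.adj _ (Fin.succ_ne_zero i)) with h | h | h
    exacts [⟨0, h.symm⟩, ⟨1, h.symm⟩, ⟨2, h.symm⟩]
  choose c hc using h
  exact ⟨c, funext (Fin.cases hp.map_root.symm hc)⟩

theorem spanningTreeCount_wheelGraph_eq_card (hm : 2 ≤ m) :
    spanningTreeCount (wheelGraph (m + 1)) = Nat.card {c : Fin (m + 1) → Fin 3 // IsTreeWord c} := by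
  rw [spanningTreeCount_eq_card_isParentMap _ 0]
  refine (Nat.card_eq_of_bijective
    (fun c => ⟨wheelMap c.1, (isParentMap_wheelMap_iff hm).2 c.2⟩) ⟨?_, ?_⟩).symm
  · intro c d h
    exact Subtype.ext (wheelMap_injective hm (congrArg Subtype.val h))
  · rintro ⟨p, hp⟩
    obtain ⟨c, rfl⟩ := exists_wheelMap_eq hm hp
    exact ⟨⟨c, (isParentMap_wheelMap_iff hm).1 hp⟩, rfl⟩

/-- The transfer matrix forbidding the letter `2` to be followed by the letter `1`. -/
def wheelTransfer : Matrix (Fin 3) (Fin 3) ℤ :=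
  .of fun a b => if ¬(a = 2 ∧ b = 1) then 1 else 0

open Finset in
theorem spanningTreeCount_wheelGraph_eq_trace (hm : 2 ≤ m) :
    (spanningTreeCount (wheelGraph (m + 1)) : ℤ) = (wheelTransfer ^ (m + 1)).trace - 2 := by
  classical
  rw [spanningTreeCount_wheelGraph_eq_card hm, ← sum_prod_cycle, Nat.card_eq_fintype_card,
    Fintype.card_subtype]
  let S : Finset (Fin (m + 1) → Fin 3) := {c | ∀ i, ¬(c i = 2 ∧ c (i + 1) = 1)}
  let T : Finset (Fin (m + 1) → Fin 3) := {fun _ => 1, fun _ => 2}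
  have hT : #T = 2 := card_pair fun h => by simpa using congrFun h 0
  have hTS : T ⊆ S := by
    intro c hc
    obtain rfl | rfl : c = (fun _ => 1) ∨ c = fun _ => 2 := by simpa [T] using hc
    all_goals simp [S]
  have hsdiff : ({c | IsTreeWord c} : Finset (Fin (m + 1) → Fin 3)) = S \ T := by
    ext c
    simp [S, T, IsTreeWord]
  have hS : (#S : ℤ) = ∑ c : Fin (m + 1) → Fin 3, ∏ i, wheelTransfer (c i) (c (i + 1)) := by
    rw [card_filter, Nat.cast_sum]
    refine sum_congr rfl fun c _ => ?_
    simp only [wheelTransfer, Matrix.of_apply, prod_ite_zero, mem_univ, forall_const,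
      prod_const_one, Nat.cast_ite, Nat.cast_one, Nat.cast_zero]
  rw [hsdiff, cast_card_sdiff hTS, hT, hS]
  rfl

theorem wheelTransfer_pow_recurrence (k : ℕ) :
    wheelTransfer ^ (k + 4) =
      (4 : ℤ) • wheelTransfer ^ (k + 3) - (4 : ℤ) • wheelTransfer ^ (k + 2) +
        wheelTransfer ^ (k + 1) := by
  have h : wheelTransfer ^ 4 =
      (4 : ℤ) • wheelTransfer ^ 3 - (4 : ℤ) • wheelTransfer ^ 2 + wheelTransfer ^ 1 := by
    have hM : wheelTransfer = !![1, 1, 1; 1, 1, 1; 1, 0, 1] := by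
      ext a b
      fin_cases a <;> fin_cases b <;> rfl
    ext a b
    fin_cases a <;> fin_cases b <;>
      simp [hM, pow_succ, Matrix.mul_apply, Fin.sum_univ_three, -zsmul_eq_mul]
  simp only [pow_add _ k, h, mul_add, mul_sub, mul_smul_comm]

end Wheel

/-- The numbers `cₙ` of spanning trees of wheels satisfy
`c_{n+1} = 4 cₙ − 4 c_{n−1} + c_{n−2}`. -/
theorem spanningTreeCount_wheelGraph_recurrence (n : ℕ) (hn : 5 ≤ n) :
    (spanningTreeCount (wheelGraph (n + 1)) : ℤ) =
      4 * spanningTreeCount (wheelGraph n) - 4 * spanningTreeCount (wheelGraph (n - 1)) +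
        spanningTreeCount (wheelGraph (n - 2)) := by
  obtain ⟨k, rfl⟩ := Nat.exists_eq_add_of_le' (show 3 ≤ n by omega)
  have h := congrArg Matrix.trace (wheelTransfer_pow_recurrence k)
  rw [show k + 3 - 1 = k + 1 + 1 by omega, show k + 3 - 2 = k + 1 by omega,
    spanningTreeCount_wheelGraph_eq_trace (by omega),
    spanningTreeCount_wheelGraph_eq_trace (m := k + 2) (by omega),
    spanningTreeCount_wheelGraph_eq_trace (by omega),
    spanningTreeCount_wheelGraph_eq_trace (by omega)]
  simp only [Matrix.trace_add, Matrix.trace_sub, Matrix.trace_smul, smul_eq_mul] at h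
  linarith
end

section
/- For every n ≥ 3, the number of spanning trees of the wheel graph Φₙ equals F_{2n+1} + F_{2n−1} − 2, that is, L_{2n} − 2 where L denotes the Lucas numbers. -/
/-- `q` moves every vertex other than `r` along an edge of `G`, fixes `r`, and all its orbits
end at `r`. -/
structure IsParentFunction {V : Type*} (G : SimpleGraph V) (r : V) (q : V → V) : Prop where
  map_root : q r = r
  adj : ∀ v, v ≠ r → G.Adj v (q v)
  exists_iterate_eq : ∀ v, ∃ k, q^[k] v = r

/-- The graph whose edges join each vertex to its image under `q`. -/
def functionGraph {V : Type*} (q : V → V) : SimpleGraph V :=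
  SimpleGraph.fromRel (fun a b => q a = b)

lemma functionGraph_adj {V : Type*} {q : V → V} {a b : V} :
    (functionGraph q).Adj a b ↔ a ≠ b ∧ (q a = b ∨ q b = a) :=
  SimpleGraph.fromRel_adj _ _ _

namespace IsParentFunction

variable {V : Type*} {G : SimpleGraph V} {r : V} {q q' : V → V}

lemma mono {H : SimpleGraph V} (h : H ≤ G) (hq : IsParentFunction H r q) :
    IsParentFunction G r q :=
  ⟨hq.map_root, fun v hv => h (hq.adj v hv), hq.exists_iterate_eq⟩

lemma functionGraph_le (hq : IsParentFunction G r q) : functionGraph q ≤ G := by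
  intro a b hab
  obtain ⟨hne, rfl | rfl⟩ := functionGraph_adj.1 hab
  · exact hq.adj a (fun h => hne (by rw [h, hq.map_root]))
  · exact (hq.adj b (fun h => hne (by rw [h, hq.map_root]))).symm

lemma connected_functionGraph (hq : IsParentFunction G r q) : (functionGraph q).Connected := by
  have reach (k : ℕ) : ∀ v, q^[k] v = r → (functionGraph q).Reachable v r := by
    induction k with
    | zero => rintro v rfl; rfl
    | succ k ih =>
      intro v hv
      by_cases h : v = q v
      · rw [Function.iterate_succ_apply, ← h] at hv
        exact ih v hv
      · exact (SimpleGraph.Adj.reachable (functionGraph_adj.2 ⟨h, .inl rfl⟩)).trans (ih _ hv)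
  have reach_root (v : V) : (functionGraph q).Reachable v r :=
    let ⟨k, hk⟩ := hq.exists_iterate_eq v
    reach k v hk
  have : Nonempty V := ⟨r⟩
  exact ⟨fun u v => (reach_root u).trans (reach_root v).symm⟩

lemma isTree_functionGraph [Finite V] (hq : IsParentFunction G r q) :
    (functionGraph q).IsTree := by
  refine SimpleGraph.isTree_iff_connected_and_card.2 ⟨hq.connected_functionGraph,
    le_antisymm ?_ hq.connected_functionGraph.card_vert_le_card_edgeSet_add_one⟩
  have hsub : (functionGraph q).edgeSet ⊆ (fun v => s(v, q v)) '' {r}ᶜ := by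
    intro e
    induction e with | _ a b
    rw [SimpleGraph.mem_edgeSet, functionGraph_adj]
    rintro ⟨hne, rfl | rfl⟩
    · exact ⟨a, fun h => hne (by rw [Set.mem_singleton_iff.1 h, hq.map_root]), rfl⟩
    · exact ⟨b, fun h => hne (by rw [Set.mem_singleton_iff.1 h, hq.map_root]), Sym2.eq_swap⟩
  have hcard : (functionGraph q).edgeSet.ncard ≤ ({r}ᶜ : Set V).ncard :=
    (Set.ncard_le_ncard hsub).trans (Set.ncard_image_le (Set.toFinite _))
  have hcompl := Set.ncard_add_ncard_compl ({r} : Set V)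
  rw [Set.ncard_singleton] at hcompl
  rw [Nat.card_coe_set_eq]
  omega

lemma map_map_ne (hq : IsParentFunction G r q) {v : V} (hv : v ≠ r) : q (q v) ≠ v := by
  intro h
  have hne : q v ≠ r := fun h' => hv (by rw [← h, h', hq.map_root])
  have key (k : ℕ) : q^[k] v = v ∨ q^[k] v = q v := by
    induction k with
    | zero => exact .inl rfl
    | succ k ih =>
      rw [Function.iterate_succ_apply']
      rcases ih with ih | ih <;> simp [ih, h]
  obtain ⟨k, hk⟩ := hq.exists_iterate_eq v
  rcases key k with h' | h'
  · exact hv (h'.symm.trans hk)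
  · exact hne (h'.symm.trans hk)

lemma eq_of_functionGraph_eq (hq : IsParentFunction G r q) (hq' : IsParentFunction G r q')
    (h : functionGraph q = functionGraph q') : q = q' := by
  have step (v : V) (hv : q v ≠ q' v) : q (q' v) ≠ q' (q' v) := by
    have hvr : v ≠ r := by
      rintro rfl
      exact hv (hq.map_root.trans hq'.map_root.symm)
    have hadj : (functionGraph q).Adj v (q' v) :=
      h ▸ functionGraph_adj.2 ⟨(hq'.adj v hvr).ne, .inl rfl⟩
    rw [(functionGraph_adj.1 hadj).2.resolve_left hv]
    exact (hq'.map_map_ne hvr).symm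
  by_contra hne
  obtain ⟨v, hv⟩ := Function.ne_iff.1 hne
  have key (k : ℕ) : q (q'^[k] v) ≠ q' (q'^[k] v) := by
    induction k with
    | zero => exact hv
    | succ k ih =>
      rw [Function.iterate_succ_apply']
      exact step _ ih
  obtain ⟨k, hk⟩ := hq'.exists_iterate_eq v
  exact key k (by rw [hk, hq.map_root, hq'.map_root])

end IsParentFunction

lemma SimpleGraph.Connected.exists_isParentFunction {V : Type*} {G : SimpleGraph V}
    (hG : G.Connected) (r : V) : ∃ q, IsParentFunction G r q := by
  have closer (v : V) (hv : v ≠ r) : ∃ w, G.Adj v w ∧ G.dist w r < G.dist v r := by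
    obtain ⟨p, hp⟩ := hG.exists_walk_length_eq_dist v r
    cases p with
    | nil => exact absurd rfl hv
    | cons hadj p =>
      refine ⟨_, hadj, ?_⟩
      have := SimpleGraph.dist_le p
      rw [SimpleGraph.Walk.length_cons] at hp
      omega
  choose! f hf using closer
  classical
  refine ⟨fun v => if v = r then r else f v, by simp, fun v hv => by simp [hv, (hf v hv).1], ?_⟩
  intro v
  induction hd : G.dist v r using Nat.strong_induction_on generalizing v with
  | _ d ih =>
    by_cases hv : v = r
    · exact ⟨0, hv⟩
    · obtain ⟨k, hk⟩ := ih _ (hd ▸ (hf v hv).2) (f v) rfl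
      exact ⟨k + 1, by rwa [Function.iterate_succ_apply, if_neg hv]⟩

/-- Orienting the edges of a tree towards a root identifies spanning trees with parent
functions. -/
theorem spanningTreeCount_eq_card_isParentFunction {V : Type*} [Finite V] (G : SimpleGraph V)
    (r : V) : spanningTreeCount G = Nat.card {q : V → V // IsParentFunction G r q} := by
  refine (Nat.card_congr (Equiv.ofBijective
    (fun q : {q : V → V // IsParentFunction G r q} =>
      (⟨functionGraph q.1, q.2.functionGraph_le, q.2.isTree_functionGraph⟩ :
        {H : SimpleGraph V // H ≤ G ∧ H.IsTree})) ⟨?_, ?_⟩)).symm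
  · intro q q' h
    exact Subtype.ext (q.2.eq_of_functionGraph_eq q'.2 (congrArg Subtype.val h))
  · rintro ⟨H, hle, hH⟩
    obtain ⟨q, hq⟩ := hH.connected.exists_isParentFunction r
    refine ⟨⟨q, hq.mono hle⟩, Subtype.ext (le_antisymm hq.functionGraph_le ?_)⟩
    exact (SimpleGraph.isTree_iff_minimal_connected.1 hH).2 hq.connected_functionGraph
      hq.functionGraph_le

namespace Matrix

variable {α R : Type*} [Fintype α] [DecidableEq α] [CommSemiring R]

lemma pow_succ_apply_eq_sum_prod (M : Matrix α α R) (k : ℕ) (a b : α) :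
    (M ^ (k + 1)) a b =
      ∑ w : Fin k → α, ∏ i : Fin (k + 1),
        M (Fin.cons (α := fun _ => α) a w i) (Fin.snoc (α := fun _ => α) w b i) := by
  induction k generalizing a with
  | zero => simp [Fin.snoc]
  | succ k ih =>
    rw [pow_succ', Matrix.mul_apply, ← (Fin.consEquiv fun _ => α).sum_comp, Fintype.sum_prod_type]
    refine Finset.sum_congr rfl fun c _ => ?_
    rw [ih, Finset.mul_sum]
    refine Finset.sum_congr rfl fun w _ => ?_
    rw [Fin.prod_univ_succ (n := k + 1)]
    simp [Fin.consEquiv, ← Fin.cons_snoc_eq_snoc_cons]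

lemma trace_pow_succ_eq_sum_prod (M : Matrix α α R) (k : ℕ) :
    (M ^ (k + 1)).trace = ∑ w : Fin (k + 1) → α, ∏ i, M (w i) (w (i + 1)) := by
  rw [← (Fin.consEquiv fun _ => α).sum_comp, Fintype.sum_prod_type]
  refine Finset.sum_congr rfl fun a _ => ?_
  rw [Matrix.diag_apply, pow_succ_apply_eq_sum_prod]
  refine Finset.sum_congr rfl fun w _ => Finset.prod_congr rfl fun i _ => ?_
  congr 1
  cases i using Fin.lastCases with
  | last => simp [Fin.consEquiv]
  | cast i => simp [Fin.consEquiv, Fin.coeSucc_eq_succ]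

/-- For a relation `P`, the trace of the `n`-th power of its indicator matrix counts the cyclic
words of length `n` in which consecutive letters are related. -/
lemma trace_indicator_pow_succ (P : α → α → Prop) [DecidableRel P] (k : ℕ) :
    ((Matrix.of fun a b => if P a b then (1 : R) else 0) ^ (k + 1)).trace =
      (Nat.card {w : Fin (k + 1) → α // ∀ i, P (w i) (w (i + 1))} : R) := by
  rw [trace_pow_succ_eq_sum_prod, Nat.card_eq_fintype_card, Fintype.card_subtype]
  simp [Finset.prod_ite_zero]

end Matrix

/-- The directions in which a cycle vertex of the wheel can point: `0` for the hub, `1` for the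
next cycle vertex, `2` for the previous one. Two consecutive cycle vertices must not point at
each other. -/
abbrev Compatible (a b : Fin 3) : Prop := ¬ (a = 1 ∧ b = 2)

lemma card_compatible_words (k : ℕ) :
    (Nat.card {w : Fin (k + 1) → Fin 3 // ∀ i, Compatible (w i) (w (i + 1))} : ℤ) =
      Nat.fib (2 * k + 3) + Nat.fib (2 * k + 1) := by
  rw [← Matrix.trace_indicator_pow_succ]
  set M : Matrix (Fin 3) (Fin 3) ℤ := Matrix.of fun a b => if Compatible a b then 1 else 0
  have hM : M ^ 3 + M = 3 • M ^ 2 := by decide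
  induction k using Nat.twoStepInduction with
  | zero => decide
  | one => decide
  | more k ih₁ ih₂ =>
    have hrec : M ^ (k + 3) + M ^ (k + 1) = 3 • M ^ (k + 2) := by
      calc M ^ (k + 3) + M ^ (k + 1) = M ^ k * (M ^ 3 + M) := by rw [mul_add, ← pow_add, ← pow_succ]
        _ = _ := by rw [hM, mul_smul_comm, ← pow_add]
    have htr := congrArg Matrix.trace hrec
    rw [Matrix.trace_add, Matrix.trace_smul] at htr
    simp only [Nat.reduceAdd, add_assoc, mul_add, Nat.reduceMul] at *
    have e1 := Nat.fib_add_two (n := 2 * k + 1)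
    have e2 := Nat.fib_add_two (n := 2 * k + 2)
    have e3 := Nat.fib_add_two (n := 2 * k + 3)
    have e4 := Nat.fib_add_two (n := 2 * k + 4)
    have e5 := Nat.fib_add_two (n := 2 * k + 5)
    simp only [add_assoc, Nat.reduceAdd, nsmul_eq_mul] at *
    push_cast at *
    grind

section Wheel

variable {m : ℕ}

lemma wheelGraph_adj_succ_zero {n : ℕ} (i : Fin n) : (wheelGraph n).Adj i.succ 0 := by
  simp [wheelGraph]

lemma wheelGraph_adj_succ_succ (i j : Fin (m + 3)) :
    (wheelGraph (m + 3)).Adj i.succ j.succ ↔ j = i + 1 ∨ i = j + 1 := by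
  have val_add_one (a : Fin (m + 3)) : ((a + 1 : Fin (m + 3)) : ℕ) = a + 1 ∧ (a : ℕ) < m + 2 ∨
      ((a + 1 : Fin (m + 3)) : ℕ) = 0 ∧ (a : ℕ) = m + 2 := by
    have ha := a.2
    rw [Fin.val_add_eq_ite, Fin.val_one]
    split_ifs <;> omega
  have hi := val_add_one i
  have hj := val_add_one j
  simp only [wheelGraph, SimpleGraph.fromRel_adj, ne_eq, Fin.ext_iff, Fin.val_succ, Fin.val_zero]
  omega

/-- The map sending the hub to itself and each cycle vertex where its direction points. -/
def directionMap (w : Fin (m + 3) → Fin 3) : Fin (m + 3 + 1) → Fin (m + 3 + 1) :=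
  Fin.cons 0 fun i => ![0, (i + 1).succ, (i - 1).succ] (w i)

lemma directionMap_zero (w : Fin (m + 3) → Fin 3) : directionMap w 0 = 0 := rfl

lemma directionMap_succ (w : Fin (m + 3) → Fin 3) (i : Fin (m + 3)) :
    directionMap w i.succ = ![0, (i + 1).succ, (i - 1).succ] (w i) := rfl

lemma directionVec_injective (i : Fin (m + 3)) :
    Function.Injective ![0, (i + 1).succ, (i - 1).succ] := by
  have h : i + 1 ≠ i - 1 := by
    intro h
    rw [sub_eq_add_neg, add_right_inj, eq_neg_iff_add_eq_zero] at h
    simp [Fin.ext_iff, Fin.val_add_eq_ite] at h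
  intro a b hab
  fin_cases a <;> fin_cases b <;> simp_all [Fin.succ_ne_zero, (Fin.succ_ne_zero _).symm, h.symm]

lemma directionMap_injective : Function.Injective (directionMap (m := m)) := by
  intro w w' h
  ext1 i
  exact directionVec_injective i (congrFun h i.succ)

lemma directionMap_adj (w : Fin (m + 3) → Fin 3) (v : Fin (m + 3 + 1)) (hv : v ≠ 0) :
    (wheelGraph (m + 3)).Adj v (directionMap w v) := by
  obtain ⟨i, rfl⟩ := Fin.exists_succ_eq.2 hv
  rw [directionMap_succ]
  generalize w i = a
  fin_cases a
  · exact wheelGraph_adj_succ_zero i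
  · exact (wheelGraph_adj_succ_succ _ _).2 (.inl rfl)
  · exact (wheelGraph_adj_succ_succ _ _).2 (.inr (sub_add_cancel i 1).symm)

lemma exists_directionMap_eq {q : Fin (m + 3 + 1) → Fin (m + 3 + 1)}
    (hq : IsParentFunction (wheelGraph (m + 3)) 0 q) : ∃ w, directionMap w = q := by
  have key (i : Fin (m + 3)) : ∃ a, ![0, (i + 1).succ, (i - 1).succ] a = q i.succ := by
    have hadj := hq.adj i.succ (Fin.succ_ne_zero i)
    generalize q i.succ = u at hadj
    cases u using Fin.cases with
    | zero => exact ⟨0, rfl⟩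
    | succ j =>
      rcases (wheelGraph_adj_succ_succ _ _).1 hadj with rfl | rfl
      · exact ⟨1, rfl⟩
      · exact ⟨2, by simp⟩
  choose w hw using key
  refine ⟨w, funext fun v => ?_⟩
  cases v using Fin.cases with
  | zero => exact hq.map_root.symm
  | succ i => exact hw i

lemma forall_of_cyclic_step {n : ℕ} [NeZero n] {p : Fin n → Prop} {i : Fin n} (hi : p i)
    (h : ∀ j, p j → p (j + 1)) (j : Fin n) : p j := by
  have key (k : ℕ) : p (i + Fin.ofNat n k) := by
    induction k with
    | zero => simpa using hi
    | succ k ih =>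
      have := h _ ih
      have hk : Fin.ofNat n k + 1 = Fin.ofNat n (k + 1) := by ext; simp [Fin.val_add]
      rwa [add_assoc, hk] at this
  have := key (j - i : Fin n)
  simpa using this

lemma isParentFunction_directionMap_iff (w : Fin (m + 3) → Fin 3) :
    IsParentFunction (wheelGraph (m + 3)) 0 (directionMap w) ↔
      (∀ i, Compatible (w i) (w (i + 1))) ∧ w ≠ (fun _ => 1) ∧ w ≠ fun _ => 2 := by
  have noreach (c : Fin 3) (hc : c ≠ 0) (k : ℕ) :
      (directionMap fun _ => c)^[k] (1 : Fin (m + 3 + 1)) ≠ 0 := by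
    induction k with
    | zero => simp
    | succ k ih =>
      obtain ⟨i, hi⟩ := Fin.exists_succ_eq.2 ih
      rw [Function.iterate_succ_apply', ← hi, directionMap_succ]
      exact (directionVec_injective i).ne hc
  constructor
  · intro h
    refine ⟨?_, ?_, ?_⟩
    · rintro i ⟨h1, h2⟩
      apply h.map_map_ne (Fin.succ_ne_zero i)
      simp [directionMap_succ, h1, h2]
    · rintro rfl
      exact (h.exists_iterate_eq _).elim (noreach 1 (by decide))
    · rintro rfl
      exact (h.exists_iterate_eq _).elim (noreach 2 (by decide))
  · rintro ⟨hc, h1, h2⟩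
    refine ⟨directionMap_zero w, directionMap_adj w, fun v => ?_⟩
    by_contra hv
    let A (v : Fin (m + 3 + 1)) : Prop := ¬ ∃ k, (directionMap w)^[k] v = 0
    have A_map {v} (h : A v) : A (directionMap w v) := fun ⟨k, hk⟩ => h ⟨k + 1, hk⟩
    have A_succ {i} (h : A i.succ) : w i ≠ 0 := fun h0 => h ⟨1, by simp [directionMap_succ, h0]⟩
    have other (a : Fin 3) : a = 0 ∨ a = 1 ∨ a = 2 := by decide +revert
    obtain ⟨i, rfl⟩ := Fin.exists_succ_eq.2 (fun h0 => hv ⟨0, h0⟩ : v ≠ 0)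
    rcases (other (w i)).resolve_left (A_succ hv) with hi | hi
    · refine h1 (funext fun j => (forall_of_cyclic_step (p := fun j => A j.succ ∧ w j = 1)
        ⟨hv, hi⟩ (fun j hj => ?_) j).2)
      have hA : A (j + 1).succ := by simpa [directionMap_succ, hj.2] using A_map hj.1
      exact ⟨hA, ((other _).resolve_left (A_succ hA)).resolve_right fun h => hc j ⟨hj.2, h⟩⟩
    · refine h2 (funext fun j => ?_)
      have key := forall_of_cyclic_step (p := fun j => A (-j).succ ∧ w (-j) = 2) (i := -i)
        (by simpa using ⟨hv, hi⟩) (fun j hj => ?_) (-j)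
      · simpa using key.2
      have hA : A (-j - 1).succ := by simpa [directionMap_succ, hj.2] using A_map hj.1
      rw [neg_add']
      exact ⟨hA, ((other _).resolve_left (A_succ hA)).resolve_left fun h =>
        hc (-j - 1) ⟨h, by simpa using hj.2⟩⟩

lemma card_parentFunctions_wheelGraph (m : ℕ) :
    Nat.card {q // IsParentFunction (wheelGraph (m + 3)) 0 q} + 2 =
      Nat.card {w : Fin (m + 3) → Fin 3 // ∀ i, Compatible (w i) (w (i + 1))} := by
  have e : {q // IsParentFunction (wheelGraph (m + 3)) 0 q} ≃
      {w : Fin (m + 3) → Fin 3 //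
        (∀ i, Compatible (w i) (w (i + 1))) ∧ w ≠ (fun _ => 1) ∧ w ≠ fun _ => 2} :=
    (Equiv.ofBijective (fun w => ⟨directionMap w.1, (isParentFunction_directionMap_iff w.1).2 w.2⟩)
      ⟨fun w w' h => Subtype.ext (directionMap_injective (congrArg Subtype.val h)), by
        rintro ⟨q, hq⟩
        obtain ⟨w, rfl⟩ := exists_directionMap_eq hq
        exact ⟨⟨w, (isParentFunction_directionMap_iff w).1 hq⟩, rfl⟩⟩).symm
  have hne : (fun _ => 2 : Fin (m + 3) → Fin 3) ≠ fun _ => 1 := fun h => by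
    simpa using congrFun h 0
  rw [Nat.card_congr e, Nat.card_eq_fintype_card, Nat.card_eq_fintype_card, Fintype.card_subtype,
    Fintype.card_subtype]
  set S := Finset.univ.filter fun w : Fin (m + 3) → Fin 3 => ∀ i, Compatible (w i) (w (i + 1))
    with hS
  have h1 : (fun _ => 1) ∈ S := by simp [hS]
  have h2 : (fun _ => 2) ∈ S.erase fun _ => 1 := Finset.mem_erase.2 ⟨hne, by simp [hS]⟩
  rw [← Finset.card_erase_add_one h1, ← Finset.card_erase_add_one h2]
  change _ = _ + 2
  congr 2
  ext w
  simp only [hS, Finset.mem_filter, Finset.mem_univ, true_and, Finset.mem_erase]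
  tauto

end Wheel

/-- The number of spanning trees of the wheel `Φₙ` is `F_{2n+1} + F_{2n−1} − 2`,
that is, the Lucas number `L₂ₙ` minus `2`. -/
theorem spanningTreeCount_wheelGraph (n : ℕ) (hn : 3 ≤ n) :
    (spanningTreeCount (wheelGraph n) : ℤ) =
      Nat.fib (2 * n + 1) + Nat.fib (2 * n - 1) - 2 := by
  obtain ⟨m, rfl⟩ := Nat.exists_eq_add_of_le' hn
  have hcard := card_compatible_words (m + 2)
  rw [← card_parentFunctions_wheelGraph, ← spanningTreeCount_eq_card_isParentFunction] at hcard
  rw [show 2 * (m + 3) + 1 = 2 * (m + 2) + 3 by ring,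
    show 2 * (m + 3) - 1 = 2 * (m + 2) + 1 by omega, ← hcard]
  push_cast
  ring
end

section
/- Matrix tree theorem (Kirchhoff): Let G be a finite simple graph on the vertex set {1,…,n} with n ≥ 2, let L be its Laplacian matrix (L has the vertex degrees on the diagonal and entry −1 in position (i,j), i ≠ j, when i and j are adjacent, 0 otherwise), and let K be the Kirchhoff minor obtained from L by deleting the last row and last column. Then the number of spanning trees of G equals det K. -/
namespace SimpleGraph

variable {V : Type*} {r : V}

/-- The graph joining every vertex other than `r` to its image under `f`. -/
def parentGraph (f : {v // v ≠ r} → V) : SimpleGraph V :=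
  fromRel fun u v => ∃ h : u ≠ r, f ⟨u, h⟩ = v

theorem parentGraph_adj_iff {f : {v // v ≠ r} → V} {u v : V} :
    (parentGraph f).Adj u v ↔
      u ≠ v ∧ ((∃ h : u ≠ r, f ⟨u, h⟩ = v) ∨ ∃ h : v ≠ r, f ⟨v, h⟩ = u) :=
  Iff.rfl

theorem parentGraph_le_iff {f : {v // v ≠ r} → V} {G : SimpleGraph V} (hf : ∀ k : {v // v ≠ r}, f k ≠ k) :
    parentGraph f ≤ G ↔ ∀ k : {v // v ≠ r}, G.Adj k (f k) := by
  constructor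
  · exact fun h k => h (parentGraph_adj_iff.2 ⟨(hf k).symm, Or.inl ⟨k.2, rfl⟩⟩)
  · rintro h u v huv
    obtain ⟨-, ⟨hu, rfl⟩ | ⟨hv, rfl⟩⟩ := parentGraph_adj_iff.1 huv
    · exact h ⟨u, hu⟩
    · exact (h ⟨v, hv⟩).symm

theorem parentGraph_reachable (f : {v // v ≠ r} → V) (k : {v // v ≠ r}) :
    (parentGraph f).Reachable k (f k) := by
  by_cases h : (k : V) = f k
  · rw [← h]
  · exact (parentGraph_adj_iff.2 ⟨h, Or.inl ⟨k.2, rfl⟩⟩).reachable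

theorem Connected.exists_adj_dist_lt {G : SimpleGraph V} (hG : G.Connected) {v : V} (hv : v ≠ r) :
    ∃ w, G.Adj v w ∧ G.dist w r < G.dist v r := by
  obtain ⟨p, hp⟩ := hG.exists_walk_length_eq_dist v r
  cases p with
  | nil => exact absurd rfl hv
  | cons h q =>
    refine ⟨_, h, ?_⟩
    have := dist_le q
    rw [Walk.length_cons] at hp
    omega

theorem eq_of_parentGraph_adj_of_dist_lt {f : {v // v ≠ r} → V} (hf : (parentGraph f).Connected)
    (k : {v // v ≠ r}) {w : V} (hw : (parentGraph f).Adj k w)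
    (hlt : (parentGraph f).dist w r < (parentGraph f).dist k r) : f k = w := by
  induction hd : (parentGraph f).dist k r using Nat.strong_induction_on generalizing k w with
  | _ d ih =>
    obtain ⟨-, ⟨_, h⟩ | ⟨hwr, h⟩⟩ := parentGraph_adj_iff.1 hw
    · exact h
    · obtain ⟨u, hu, hu_lt⟩ := hf.exists_adj_dist_lt hwr
      have hku : f ⟨w, hwr⟩ = u := ih _ (hd ▸ hlt) ⟨w, hwr⟩ hu hu_lt rfl
      rw [← hku, h] at hu_lt
      exact absurd hu_lt hlt.asymm

theorem parentGraph_dist_lt {f : {v // v ≠ r} → V} (hf : (parentGraph f).Connected)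
    (k : {v // v ≠ r}) : (parentGraph f).dist (f k) r < (parentGraph f).dist k r := by
  obtain ⟨w, hw, hlt⟩ := hf.exists_adj_dist_lt k.2
  rwa [eq_of_parentGraph_adj_of_dist_lt hf k hw hlt]

theorem parentGraph_injOn_connected :
    Set.InjOn (parentGraph (r := r)) {f | (parentGraph f).Connected} := by
  intro f hf g hg hfg
  ext k
  obtain ⟨w, hw, hlt⟩ := Connected.exists_adj_dist_lt hf k.2
  rw [eq_of_parentGraph_adj_of_dist_lt hf k hw hlt]
  rw [hfg] at hw hlt
  rw [eq_of_parentGraph_adj_of_dist_lt hg k hw hlt]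

theorem parentGraph_isTree [Finite V] {f : {v // v ≠ r} → V} (hf : (parentGraph f).Connected) :
    (parentGraph f).IsTree := by
  classical
  have := Fintype.ofFinite V
  refine isTree_iff_connected_and_card.2 ⟨hf, le_antisymm ?_ hf.card_vert_le_card_edgeSet_add_one⟩
  have hsub : (parentGraph f).edgeSet ⊆ Set.range fun k : {v // v ≠ r} => s((k : V), f k) := by
    intro e he
    induction e with
    | _ u v =>
      obtain ⟨-, ⟨hu, rfl⟩ | ⟨hv, rfl⟩⟩ := parentGraph_adj_iff.1 ((mem_edgeSet _).1 he)
      · exact ⟨⟨u, hu⟩, rfl⟩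
      · exact ⟨⟨v, hv⟩, Sym2.eq_swap⟩
  have hle : Nat.card (parentGraph f).edgeSet ≤ Nat.card {v // v ≠ r} :=
    (Nat.card_mono (Set.finite_range _) hsub).trans (Finite.card_range_le _)
  have hcard : Nat.card {v // v ≠ r} = Nat.card V - 1 := by
    rw [Nat.card_eq_fintype_card, Nat.card_eq_fintype_card]
    simp
  have : 0 < Nat.card V := Nat.card_pos_iff.2 ⟨⟨r⟩, inferInstance⟩
  omega

theorem IsTree.exists_parentGraph_eq_s12 {T : SimpleGraph V} (hT : T.IsTree) (r : V) :
    ∃ f : {v // v ≠ r} → V, parentGraph f = T := by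
  choose f hf hlt using fun k : {v // v ≠ r} => hT.connected.exists_adj_dist_lt k.2
  have hle : parentGraph f ≤ T := (parentGraph_le_iff fun k => (hf k).ne').2 hf
  have hreach (v : V) : (parentGraph f).Reachable v r := by
    induction hd : T.dist v r using Nat.strong_induction_on generalizing v with
    | _ d ih =>
      by_cases hv : v = r
      · rw [hv]
      · exact (parentGraph_reachable f ⟨v, hv⟩).trans (ih _ (hd ▸ hlt ⟨v, hv⟩) _ rfl)
  have : Nonempty V := ⟨r⟩
  have hconn : (parentGraph f).Connected := ⟨fun u v => (hreach u).trans (hreach v).symm⟩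
  exact ⟨f, le_antisymm hle ((isTree_iff_minimal_connected.1 hT).2 hconn hle)⟩

variable [Fintype V] [DecidableEq V]

/-- The matrix whose row at `k` is the difference of the indicators of `k` and `f k`, with the
coordinate at `r` dropped. -/
def parentMatrix (f : {v // v ≠ r} → V) : Matrix {v // v ≠ r} {v // v ≠ r} ℤ :=
  Matrix.of fun i j => (if i = j then 1 else 0) - if f i = j then 1 else 0

theorem det_parentMatrix_of_connected {f : {v // v ≠ r} → V} (hf : (parentGraph f).Connected) :
    (parentMatrix f).det = 1 := by
  have hlt := parentGraph_dist_lt hf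
  let b : {v // v ≠ r} → ℕᵒᵈ := fun k => OrderDual.toDual ((parentGraph f).dist k r)
  have htri : (parentMatrix f).BlockTriangular b := by
    intro i j hij
    have hij : (parentGraph f).dist i r < (parentGraph f).dist j r := hij
    have h₁ : i ≠ j := by rintro rfl; exact hij.false
    have h₂ : f i ≠ j := fun h => hij.asymm (h ▸ hlt i)
    simp [parentMatrix, h₁, h₂]
  rw [htri.det]
  refine Finset.prod_eq_one fun a _ => ?_
  have : (parentMatrix f).toSquareBlock b a = 1 := by
    ext ⟨i, hi⟩ ⟨j, hj⟩
    have hij : (parentGraph f).dist i r = (parentGraph f).dist j r :=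
      OrderDual.toDual.injective (hi.trans hj.symm)
    have h : f i ≠ j := fun h => (h ▸ hlt i).ne' hij
    simp [parentMatrix, Matrix.toSquareBlock_def, h, Matrix.one_apply]
  rw [this, Matrix.det_one]

theorem det_parentMatrix_of_not_connected {f : {v // v ≠ r} → V}
    (hf : ¬ (parentGraph f).Connected) : (parentMatrix f).det = 0 := by
  classical
  obtain ⟨v, hv⟩ : ∃ v, ¬ (parentGraph f).Reachable v r := by
    by_contra! h
    have : Nonempty V := ⟨r⟩
    exact hf ⟨fun u v => (h u).trans (h v).symm⟩
  have hvr : v ≠ r := by rintro rfl; exact hv .rfl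
  let y : V → ℤ := fun u => if (parentGraph f).Reachable u r then 0 else 1
  refine Matrix.exists_mulVec_eq_zero_iff.1 ⟨fun k => y k, fun h => ?_, ?_⟩
  · simpa [y, hv] using congrFun h ⟨v, hvr⟩
  · ext i
    have hy : y i = y (f i) := by
      have h := parentGraph_reachable f i
      simp only [y, show (parentGraph f).Reachable i r ↔ (parentGraph f).Reachable (f i) r from
        ⟨h.symm.trans, h.trans⟩]
    have hsum : ∑ j : {v // v ≠ r}, (if f i = j then y j else 0) = y (f i) := by
      by_cases hr : f i = r
      · rw [Finset.sum_eq_zero fun j _ => if_neg fun h => j.2 (h.symm.trans hr)]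
        simp [y, hr]
      · rw [Finset.sum_eq_single ⟨f i, hr⟩] <;> simp +contextual
        grind
    simp [parentMatrix, Matrix.mulVec, dotProduct, sub_mul, Finset.sum_sub_distrib, hsum, hy]

theorem det_lapMatrix_submatrix_eq_sum (G : SimpleGraph V) [DecidableRel G.Adj] (r : V) :
    ((G.lapMatrix ℤ).submatrix (Subtype.val : {v // v ≠ r} → V) Subtype.val).det =
      ∑ f ∈ Fintype.piFinset fun k : {v // v ≠ r} => G.neighborFinset k, (parentMatrix f).det := by
  let row (i : {v // v ≠ r}) (w : V) : {v // v ≠ r} → ℤ :=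
    fun j => (if i = j then 1 else 0) - if w = j then 1 else 0
  have hrow : (G.lapMatrix ℤ).submatrix (Subtype.val : {v // v ≠ r} → V) Subtype.val =
      fun i : {v // v ≠ r} => ∑ w ∈ G.neighborFinset (i : V), row i w := by
    ext i j
    simp [row, lapMatrix, degMatrix, Matrix.diagonal_apply, Finset.sum_apply,
      Finset.sum_sub_distrib, Subtype.ext_iff]
  rw [hrow]
  exact Matrix.detRowAlternating.toMultilinearMap.map_sum_finset row _

/-- The matrix tree theorem, with the row and column of an arbitrary vertex deleted. -/
theorem spanningTreeCount_eq_det_lapMatrix_submatrix (G : SimpleGraph V) [DecidableRel G.Adj]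
    (r : V) :
    (spanningTreeCount G : ℤ) =
      ((G.lapMatrix ℤ).submatrix (Subtype.val : {v // v ≠ r} → V) Subtype.val).det := by
  classical
  let S : Finset ({v // v ≠ r} → V) :=
    {f ∈ Fintype.piFinset fun k => G.neighborFinset k | (parentGraph f).Connected}
  have hdet (f : {v // v ≠ r} → V) :
      (parentMatrix f).det = if (parentGraph f).Connected then 1 else 0 := by
    split_ifs with hf
    exacts [det_parentMatrix_of_connected hf, det_parentMatrix_of_not_connected hf]
  have hS (f : {v // v ≠ r} → V) : f ∈ S ↔ parentGraph f ≤ G ∧ (parentGraph f).IsTree := by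
    simp only [S, Finset.mem_filter, Fintype.mem_piFinset, mem_neighborFinset]
    constructor
    · rintro ⟨h, hf⟩
      exact ⟨(parentGraph_le_iff fun k => (h k).ne').2 h, parentGraph_isTree hf⟩
    · rintro ⟨hle, hf⟩
      refine ⟨(parentGraph_le_iff fun k h => ?_).1 hle, hf.connected⟩
      exact (parentGraph_dist_lt hf.connected k).ne (by rw [h])
  have hbij : Function.Bijective fun f : S =>
      (⟨parentGraph f.1, (hS f).1 f.2⟩ : {H : SimpleGraph V // H ≤ G ∧ H.IsTree}) := by
    refine ⟨fun f g hfg => Subtype.ext ?_, ?_⟩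
    · exact parentGraph_injOn_connected ((hS f).1 f.2).2.connected ((hS g).1 g.2).2.connected
        (congrArg Subtype.val hfg)
    · rintro ⟨T, hTG, hT⟩
      obtain ⟨f, rfl⟩ := hT.exists_parentGraph_eq_s12 r
      exact ⟨⟨f, (hS f).2 ⟨hTG, hT⟩⟩, rfl⟩
  rw [det_lapMatrix_submatrix_eq_sum, spanningTreeCount, ← Nat.card_eq_of_bijective _ hbij]
  rw [Nat.card_eq_fintype_card, Fintype.card_coe]
  simp only [hdet, Finset.sum_boole, S]

end SimpleGraph

/-- Matrix tree theorem (Kirchhoff): for a finite simple graph on `n + 2 ≥ 2`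
vertices, the number of spanning trees equals the determinant of the Kirchhoff
minor, obtained from the Laplacian matrix (degrees on the diagonal, `−1` at `(i,j)`
when `i ≠ j` are adjacent, `0` otherwise) by deleting the last row and column. -/
theorem matrixTreeTheorem (n : ℕ) (G : SimpleGraph (Fin (n + 2)))
    [DecidableRel G.Adj] :
    (spanningTreeCount G : ℤ) =
      Matrix.det
        ((Matrix.of fun i j : Fin (n + 2) =>
            if i = j then (G.degree i : ℤ) else if G.Adj i j then -1 else 0).submatrix
          Fin.castSucc Fin.castSucc) := by
  have h : (Matrix.of fun i j : Fin (n + 2) =>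
      if i = j then (G.degree i : ℤ) else if G.Adj i j then -1 else 0) = G.lapMatrix ℤ := by
    ext i j
    by_cases hij : i = j
    · simp [SimpleGraph.lapMatrix, SimpleGraph.degMatrix, hij]
    · by_cases hadj : G.Adj i j <;>
        simp [SimpleGraph.lapMatrix, SimpleGraph.degMatrix, hij, hadj]
  rw [h, G.spanningTreeCount_eq_det_lapMatrix_submatrix (Fin.last (n + 1)),
    ← Matrix.det_submatrix_equiv_self (finSuccAboveEquiv (Fin.last (n + 1))),
    Matrix.submatrix_submatrix]
  congr 1
  ext i j
  simp [finSuccAboveEquiv]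
end

section
/- For all m, n ≥ 1, the number of spanning trees of the complete bipartite graph Π_{m,n} equals m^{n−1} · n^{m−1}. -/
open Finset Matrix

namespace SimpleGraph

section FunctionalGraph

variable {V : Type*}

/-- The graph joining every vertex `v` to its image `p v`. -/
def functionalGraph (p : V → V) : SimpleGraph V :=
  fromRel fun v w => p v = w

theorem functionalGraph_adj {p : V → V} {v w : V} :
    (functionalGraph p).Adj v w ↔ v ≠ w ∧ (p v = w ∨ p w = v) :=
  fromRel_adj _ _ _

theorem functionalGraph_connected {p : V → V} {r : V} (hp : ∀ v, ∃ k, p^[k] v = r) :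
    (functionalGraph p).Connected := by
  have reach : ∀ k v, p^[k] v = r → (functionalGraph p).Reachable v r := by
    intro k
    induction k with
    | zero => rintro v rfl; rfl
    | succ k ih =>
      intro v hv
      have h := ih (p v) hv
      by_cases hpv : v = p v
      · rwa [← hpv] at h
      · exact (functionalGraph_adj.2 ⟨hpv, Or.inl rfl⟩).reachable.trans h
  refine (connected_iff_exists_forall_reachable _).2 ⟨r, fun v => ?_⟩
  obtain ⟨k, hk⟩ := hp v
  exact (reach k v hk).symm

theorem functionalGraph_isTree [Finite V] {p : V → V} {r : V} (hr : p r = r)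
    (hp : ∀ v, ∃ k, p^[k] v = r) : (functionalGraph p).IsTree := by
  have hconn := functionalGraph_connected hp
  refine isTree_iff_connected_and_card.2 ⟨hconn, le_antisymm ?_
    hconn.card_vert_le_card_edgeSet_add_one⟩
  have hsub : (functionalGraph p).edgeSet ⊆ (fun v => s(v, p v)) '' {r}ᶜ := by
    intro e
    induction e with
    | h v w =>
      rw [mem_edgeSet, functionalGraph_adj]
      rintro ⟨hne, rfl | rfl⟩
      · exact ⟨v, by rintro rfl; exact hne hr.symm, rfl⟩
      · exact ⟨w, by rintro rfl; exact hne hr, Sym2.eq_swap⟩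
  have h1 := (Set.ncard_le_ncard hsub (Set.toFinite _)).trans (Set.ncard_image_le (Set.toFinite _))
  have h2 := Set.ncard_add_ncard_compl ({r} : Set V)
  rw [Set.ncard_singleton] at h2
  rw [Nat.card_coe_set_eq]
  omega

theorem functionalGraph_injOn (r : V) :
    Set.InjOn functionalGraph
      {p : V → V | p r = r ∧ (∀ v, v ≠ r → p v ≠ v) ∧ ∀ v, ∃ k, p^[k] v = r} := by
  rintro p ⟨hpr, hpne, hp⟩ q ⟨hqr, hqne, -⟩ hpq
  have key : ∀ k v, p^[k] v = r → p v = q v := by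
    intro k
    induction k with
    | zero => rintro v rfl; exact hpr.trans hqr.symm
    | succ k ih =>
      intro v hv
      by_cases hvr : v = r
      · rw [hvr, hpr, hqr]
      have hadj : (functionalGraph p).Adj v (p v) :=
        functionalGraph_adj.2 ⟨(hpne v hvr).symm, Or.inl rfl⟩
      rw [hpq, functionalGraph_adj] at hadj
      obtain h | h := hadj.2
      · exact h.symm
      · have hloop : p (p v) = v := (ih (p v) hv).trans h
        have hmem : ∀ j, p^[j] v = v ∨ p^[j] v = p v := by
          intro j
          induction j with
          | zero => exact Or.inl rfl
          | succ j ihj =>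
            rw [Function.iterate_succ_apply']
            obtain h' | h' := ihj <;> simp [h', hloop]
        obtain h' | h' := hmem (k + 1)
        · exact absurd (h'.symm.trans hv) hvr
        · have hpv : p v = r := h'.symm.trans hv
          rw [hpv, hqr] at h
          exact absurd h.symm hvr
  funext v
  obtain ⟨k, hk⟩ := hp v
  exact key k v hk

theorem IsTree.exists_functionalGraph_eq {H : SimpleGraph V} (hH : H.IsTree) (r : V) :
    ∃ p : V → V, p r = r ∧ (∀ v, v ≠ r → H.Adj v (p v)) ∧ (∀ v, ∃ k, p^[k] v = r) ∧
      functionalGraph p = H := by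
  classical
  have hstep : ∀ v, ∃ w, (v = r → w = r) ∧ (v ≠ r → H.Adj v w ∧ H.dist w r < H.dist v r) := by
    intro v
    by_cases hv : v = r
    · exact ⟨r, fun _ => rfl, fun h => absurd hv h⟩
    obtain ⟨W, hW⟩ := hH.connected.exists_walk_length_eq_dist v r
    cases W with
    | nil => exact absurd rfl hv
    | cons h W =>
      refine ⟨_, fun h' => absurd h' hv, fun _ => ⟨h, ?_⟩⟩
      have := dist_le W
      rw [Walk.length_cons] at hW
      omega
  choose p hpr hp using hstep
  have hterm : ∀ d v, H.dist v r ≤ d → ∃ k, p^[k] v = r := by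
    intro d
    induction d with
    | zero => exact fun v hv => ⟨0, hH.connected.dist_eq_zero_iff.1 (Nat.le_zero.1 hv)⟩
    | succ d ih =>
      intro v hv
      by_cases hvr : v = r
      · exact ⟨0, hvr⟩
      obtain ⟨k, hk⟩ := ih (p v) (by have := (hp v hvr).2; omega)
      exact ⟨k + 1, hk⟩
  have hroot : ∀ v, ∃ k, p^[k] v = r := fun v => hterm _ v le_rfl
  refine ⟨p, hpr r rfl, fun v hv => (hp v hv).1, hroot, ?_⟩
  refine (isTree_iff_minimal_connected.1 hH).eq_of_le (functionalGraph_connected hroot) ?_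
  intro v w hvw
  obtain ⟨hne, rfl | rfl⟩ := functionalGraph_adj.1 hvw
  · exact (hp v fun h => hne (by rw [hpr v h, h])).1
  · exact (hp w fun h => hne (by rw [hpr w h, h])).1.symm

end FunctionalGraph

end SimpleGraph

section RootedDeterminant

variable {V : Type*} [Fintype V] [DecidableEq V]

theorem Matrix.det_one_sub_of_isNilpotent {R : Type*} [CommRing R] [IsDomain R]
    {P : Matrix V V R} (hP : IsNilpotent P) : (1 - P).det = 1 := by
  have h := (isNilpotent_charpoly_sub_pow_of_isNilpotent hP).eq_zero
  have h1 := P.eval_charpoly 1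
  rw [sub_eq_zero.1 h] at h1
  simpa using h1.symm

/-- The row at `v` of the matrix `1 - P`, where `P` sends every `v ≠ r` to `w` and kills `r`. -/
def parentRow (r v w : V) : V → ℚ :=
  if v = r then Pi.single r 1 else Pi.single v 1 - Pi.single w 1

theorem det_parentRow_eq_one {p : V → V} {r : V} (hr : p r = r)
    (hp : ∀ v, ∃ k, p^[k] v = r) : (of fun v => parentRow r v (p v)).det = 1 := by
  let P : Matrix V V ℚ := of fun v => if v = r then 0 else Pi.single (p v) 1
  have hM : (of fun v => parentRow r v (p v)) = 1 - P := by
    ext v w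
    by_cases hv : v = r
    · subst hv
      simp [P, parentRow, Matrix.one_eq_pi_single]
    · simp [P, parentRow, hv, Matrix.one_eq_pi_single]
  have hrow : ∀ k v, p^[k] v = r → ∀ w, (P ^ (k + 1)) v w = 0 := by
    intro k
    induction k with
    | zero => rintro v rfl w; simp [P]
    | succ k ih =>
      intro v hv w
      rw [pow_succ', Matrix.mul_apply]
      refine Finset.sum_eq_zero fun u _ => ?_
      by_cases hu : p v = u
      · rw [ih u (hu ▸ hv), mul_zero]
      · by_cases hvr : v = r <;> simp [P, hvr, Ne.symm hu]
  choose k hk using hp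
  rw [hM]
  refine det_one_sub_of_isNilpotent ⟨univ.sup k + 1, ?_⟩
  ext v w
  refine hrow _ v ?_ w
  obtain ⟨j, hj⟩ := Nat.exists_eq_add_of_le' (Finset.le_sup (f := k) (mem_univ v))
  rw [hj, Function.iterate_add_apply, hk]
  exact Function.iterate_fixed hr j

theorem det_parentRow_eq_zero {p : V → V} {r : V}
    (hp : ¬ ∀ v, ∃ k, p^[k] v = r) : (of fun v => parentRow r v (p v)).det = 0 := by
  classical
  push Not at hp
  obtain ⟨a, ha⟩ := hp
  refine exists_mulVec_eq_zero_iff.1 ⟨fun v => if ∃ k, p^[k] v = r then 0 else 1, ?_, ?_⟩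
  · intro h
    simpa [ha] using congrFun h a
  · ext v
    by_cases hv : v = r
    · have : ∃ k, p^[k] r = r := ⟨0, rfl⟩
      simp [mulVec, parentRow, hv, this]
    · have hiff : (∃ k, p^[k] v = r) ↔ ∃ k, p^[k] (p v) = r := by
        constructor
        · rintro ⟨_ | k, hk⟩
          · exact absurd hk hv
          · exact ⟨k, hk⟩
        · rintro ⟨k, hk⟩
          exact ⟨k + 1, hk⟩
      change parentRow r v (p v) ⬝ᵥ _ = 0
      rw [parentRow, if_neg hv, sub_dotProduct, single_one_dotProduct, single_one_dotProduct]
      simp only [hiff, sub_self]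

open Classical in
/-- The **matrix-tree theorem**: the number of spanning trees is the determinant of the Laplacian
with the row of a chosen root replaced by the corresponding unit vector. -/
theorem spanningTreeCount_eq_det (G : SimpleGraph V) [DecidableRel G.Adj] (r : V) :
    (spanningTreeCount G : ℚ) = ((G.lapMatrix ℚ).updateRow r (Pi.single r 1)).det := by
  let t : V → Finset V := fun v => if v = r then {r} else G.neighborFinset v
  have ht : ∀ p : V → V, p ∈ Fintype.piFinset t ↔ p r = r ∧ ∀ v, v ≠ r → G.Adj v (p v) := by
    intro p
    rw [Fintype.mem_piFinset]
    constructor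
    · intro h
      exact ⟨by simpa [t] using h r, fun v hv => by simpa [t, hv] using h v⟩
    · rintro ⟨h1, h2⟩ v
      by_cases hv : v = r
      · simp [t, hv, h1]
      · simpa [t, hv] using h2 v hv
  have hcount : spanningTreeCount G =
      #{p ∈ Fintype.piFinset t | ∀ v, ∃ k, p^[k] v = r} := by
    rw [spanningTreeCount, ← Set.ncard_coe_finset]
    symm
    refine Set.ncard_congr (t := {H : SimpleGraph V | H ≤ G ∧ H.IsTree})
      (fun p _ => SimpleGraph.functionalGraph p) ?_ ?_ ?_
    · intro p hp
      rw [mem_coe, mem_filter, ht] at hp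
      obtain ⟨⟨hpr, hadj⟩, hroot⟩ := hp
      refine ⟨fun v w hvw => ?_, SimpleGraph.functionalGraph_isTree hpr hroot⟩
      obtain ⟨hne, rfl | rfl⟩ := SimpleGraph.functionalGraph_adj.1 hvw
      · exact hadj v fun h => hne (by rw [h, hpr])
      · exact (hadj w fun h => hne (by rw [h, hpr])).symm
    · intro p q hp hq hpq
      rw [mem_coe, mem_filter, ht] at hp hq
      exact SimpleGraph.functionalGraph_injOn r
        ⟨hp.1.1, fun v hv => (hp.1.2 v hv).ne', hp.2⟩
        ⟨hq.1.1, fun v hv => (hq.1.2 v hv).ne', hq.2⟩ hpq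
    · rintro H ⟨hle, hH⟩
      obtain ⟨p, hpr, hadj, hroot, rfl⟩ := hH.exists_functionalGraph_eq r
      refine ⟨p, ?_, rfl⟩
      rw [mem_coe, mem_filter, ht]
      exact ⟨⟨hpr, fun v hv => hle (hadj v hv)⟩, hroot⟩
  have hrows : (G.lapMatrix ℚ).updateRow r (Pi.single r 1) =
      of fun v => ∑ w ∈ t v, parentRow r v w := by
    ext v u
    by_cases hv : v = r
    · subst hv
      simp [t, parentRow]
    · simp [t, hv, parentRow, SimpleGraph.lapMatrix, SimpleGraph.degMatrix, Finset.sum_apply,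
        Pi.single_apply, diagonal_apply, SimpleGraph.adjMatrix_apply, eq_comm (a := u) (b := v)]
  rw [hrows, hcount]
  have hsum := (detRowAlternating (R := ℚ) (n := V)).toMultilinearMap.map_sum_finset
    (fun v w => parentRow r v w) t
  refine Eq.trans ?_ hsum.symm
  rw [card_filter, Nat.cast_sum]
  refine sum_congr rfl fun p hp => ?_
  split_ifs with hroot
  · exact (Nat.cast_one.trans (det_parentRow_eq_one ((ht p).1 hp).1 hroot).symm)
  · exact (Nat.cast_zero.trans (det_parentRow_eq_zero hroot).symm)

end RootedDeterminant

/-- The Laplacian of a complete bipartite graph with the row of one left vertex replaced by a unit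
vector, in block form. -/
theorem updateRow_lapMatrix_completeBipartiteGraph (a n : ℕ)
    [DecidableRel (completeBipartiteGraph (Fin (a + 1)) (Fin n)).Adj] :
    ((completeBipartiteGraph (Fin (a + 1)) (Fin n)).lapMatrix ℚ).updateRow (Sum.inl 0)
        (Pi.single (Sum.inl 0) 1) =
      fromBlocks (diagonal fun i => if i = 0 then 1 else (n : ℚ))
        (of fun i _ => if i = 0 then 0 else -1)
        (of fun _ _ => -1) (diagonal fun _ => ((a + 1 : ℕ) : ℚ)) := by
  have hl : ∀ i, (completeBipartiteGraph (Fin (a + 1)) (Fin n)).degree (Sum.inl i) = n := by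
    intro i
    have h : (completeBipartiteGraph (Fin (a + 1)) (Fin n)).neighborFinset (Sum.inl i) =
        univ.map Function.Embedding.inr := by
      ext (j | j) <;> simp
    rw [← SimpleGraph.card_neighborFinset_eq_degree, h, card_map, card_univ, Fintype.card_fin]
  have hr : ∀ j, (completeBipartiteGraph (Fin (a + 1)) (Fin n)).degree (Sum.inr j) = a + 1 := by
    intro j
    have h : (completeBipartiteGraph (Fin (a + 1)) (Fin n)).neighborFinset (Sum.inr j) =
        univ.map Function.Embedding.inl := by
      ext (i | i) <;> simp
    rw [← SimpleGraph.card_neighborFinset_eq_degree, h, card_map, card_univ, Fintype.card_fin]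
  ext (i | i) (j | j)
  · cases i using Fin.cases <;>
    simp [updateRow_apply, SimpleGraph.lapMatrix, SimpleGraph.degMatrix, diagonal_apply, hl,
      Pi.single_apply, eq_comm]
  · cases i using Fin.cases <;>
    simp [updateRow_apply, SimpleGraph.lapMatrix, SimpleGraph.degMatrix]
  · simp [updateRow_apply, SimpleGraph.lapMatrix, SimpleGraph.degMatrix]
  · simp [updateRow_apply, SimpleGraph.lapMatrix, SimpleGraph.degMatrix, diagonal_apply, hr]

theorem det_rootedLaplacian_completeBipartite (a b : ℕ) :
    (fromBlocks (diagonal fun i => if i = 0 then 1 else ((b + 1 : ℕ) : ℚ))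
      (of fun (i : Fin (a + 1)) (_ : Fin (b + 1)) => if i = 0 then 0 else (-1 : ℚ))
      (of fun _ _ => -1) (diagonal fun _ => ((a + 1 : ℕ) : ℚ))).det =
      (a + 1) ^ b * (b + 1) ^ a := by
  have ha : (a + 1 : ℚ) ≠ 0 := by positivity
  let D : Matrix (Fin (b + 1)) (Fin (b + 1)) ℚ := diagonal fun _ => ((a + 1 : ℕ) : ℚ)
  let E : Matrix (Fin (a + 1)) (Fin (a + 1)) ℚ :=
    diagonal fun i => if i = 0 then 1 else ((b + 1 : ℕ) : ℚ)
  let _ : Invertible D :=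
    ⟨diagonal fun _ => ((a + 1 : ℕ) : ℚ)⁻¹, by simp [D, ha], by simp [D, ha]⟩
  let u : Fin (a + 1) → ℚ := fun i => if i = 0 then 0 else -(a + 1 : ℚ)⁻¹
  have hE : E.det = (b + 1) ^ a := by simp [E, Fin.prod_univ_succ]
  rw [det_fromBlocks₂₂ (D := D)]
  have hS : E - (of fun (i : Fin (a + 1)) (_ : Fin (b + 1)) => if i = 0 then 0 else (-1 : ℚ))
      * ⅟D * (of fun (_ : Fin (b + 1)) (_ : Fin (a + 1)) => (-1 : ℚ)) =
      E * (1 + replicateCol Unit u * replicateRow Unit (1 : Fin (a + 1) → ℚ)) := by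
    ext i j
    change _ - (_ * diagonal _ * _ : Matrix _ _ ℚ) i j = _
    rw [mul_apply, diagonal_mul]
    by_cases hi : i = 0
    · simp [E, u, hi, mul_apply, diagonal_apply, one_apply, eq_comm]
    · simp [E, u, hi, mul_apply, diagonal_apply, one_apply]
      split_ifs <;> ring
  rw [hS, det_mul, hE, det_one_add_replicateCol_mul_replicateRow]
  simp [D, u, dotProduct, Fin.sum_univ_succ]
  field_simp
  ring

/-- The complete bipartite graph with parts of sizes `m, n ≥ 1` has
`m ^ (n−1) ⬝ n ^ (m−1)` spanning trees. -/
theorem spanningTreeCount_completeBipartite (m n : ℕ) (hm : 1 ≤ m) (hn : 1 ≤ n) :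
    spanningTreeCount (completeBipartiteGraph (Fin m) (Fin n)) =
      m ^ (n - 1) * n ^ (m - 1) := by
  classical
  obtain ⟨a, rfl⟩ := Nat.exists_eq_add_of_le' hm
  obtain ⟨b, rfl⟩ := Nat.exists_eq_add_of_le' hn
  have h := spanningTreeCount_eq_det (completeBipartiteGraph (Fin (a + 1)) (Fin (b + 1)))
    (Sum.inl 0)
  rw [updateRow_lapMatrix_completeBipartiteGraph, det_rootedLaplacian_completeBipartite] at h
  rw [Nat.add_sub_cancel, Nat.add_sub_cancel]
  exact_mod_cast h
end
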